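/- arXiv:math/9504205 — 2 statements merged into one kernel-verified Lean document; each statement's English description precedes it below -/
import Mathlib

section
/- Let X be a separable Banach space and let T : L1 → X be a bounded linear operator that is not completely continuous. Then there exist a linear isometric embedding A : L1 → L1 and a bounded linear operator B : X → c0 such that for every f ∈ L1 and every n ≥ 0, (B(T(A f)))_n = ∫ r_n f dμ; in other words, T0 factors through T with the right-hand factor taking values in c0. -/
open MeasureTheory Filter Topology
open scoped ZeroAtInfty

/-- Lebesgue measure on `[0,1]`. -/
noncomputable def mu : Measure ℝ := volume.restrict (Set.Icc 0 1)

/-- The `n`-th Rademacher function `r_n(t) = (-1)^⌊2^n t⌋`. -/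
noncomputable def rademacher (n : ℕ) (t : ℝ) : ℝ := (-1 : ℝ) ^ ⌊(2 : ℝ) ^ n * t⌋

/-- A bounded linear operator between Banach spaces is completely continuous if it maps
weakly convergent sequences to norm convergent sequences. -/
def CompletelyContinuous {X Z : Type*} [NormedAddCommGroup X] [NormedSpace ℝ X]
    [NormedAddCommGroup Z] [NormedSpace ℝ Z] (T : X →L[ℝ] Z) : Prop :=
  ∀ (x : ℕ → X) (x₀ : X),
    (∀ φ : X →L[ℝ] ℝ, Tendsto (fun n => φ (x n)) atTop (𝓝 (φ x₀))) →
    Tendsto (fun n => T (x n)) atTop (𝓝 (T x₀))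

section Bounded

variable {α : Type*} [MeasurableSpace α] {μ : Measure α}

/-- Real functions that are measurable and bounded. -/
def BddMeas (u : α → ℝ) : Prop := Measurable u ∧ ∃ K, ∀ t, |u t| ≤ K

namespace BddMeas

variable {u v : α → ℝ}

theorem measurable (hu : BddMeas u) : Measurable u := hu.1

theorem integrable_mul (hu : BddMeas u) {f : α → ℝ} (hf : Integrable f μ) :
    Integrable (fun t => u t * f t) μ := by
  obtain ⟨hm, K, hK⟩ := hu
  exact hf.bdd_mul hm.aestronglyMeasurable (c := K) (ae_of_all _ hK)

theorem integrable [IsFiniteMeasure μ] (hu : BddMeas u) : Integrable u μ := by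
  simpa using hu.integrable_mul (integrable_const (μ := μ) (1 : ℝ))

theorem const (c : ℝ) : BddMeas (fun _ : α => c) := ⟨measurable_const, |c|, fun _ => le_rfl⟩

theorem add (hu : BddMeas u) (hv : BddMeas v) : BddMeas (fun t => u t + v t) := by
  obtain ⟨hm, K, hK⟩ := hu
  obtain ⟨hm', L, hL⟩ := hv
  exact ⟨hm.add hm', K + L, fun t => (abs_add_le _ _).trans (add_le_add (hK t) (hL t))⟩

theorem mul (hu : BddMeas u) (hv : BddMeas v) : BddMeas (fun t => u t * v t) := by
  obtain ⟨hm, K, hK⟩ := hu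
  obtain ⟨hm', L, hL⟩ := hv
  refine ⟨hm.mul hm', K * L, fun t => ?_⟩
  rw [abs_mul]
  exact mul_le_mul (hK t) (hL t) (abs_nonneg _) ((abs_nonneg _).trans (hK t))

theorem const_mul (c : ℝ) (hu : BddMeas u) : BddMeas (fun t => c * u t) := (const c).mul hu

theorem sub (hu : BddMeas u) (hv : BddMeas v) : BddMeas (fun t => u t - v t) := by
  simpa [sub_eq_add_neg] using hu.add (hv.const_mul (-1))

theorem indicator (hu : BddMeas u) {s : Set α} (hs : MeasurableSet s) :
    BddMeas (s.indicator u) := by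
  obtain ⟨hm, K, hK⟩ := hu
  refine ⟨hm.indicator hs, K, fun t => ?_⟩
  by_cases h : t ∈ s
  · simpa [h] using hK t
  · simpa [h] using (abs_nonneg _).trans (hK t)

end BddMeas

end Bounded

section Duality

variable {α : Type*} [MeasurableSpace α] {μ : Measure α}

/-- A bounded function defines a bounded functional on `L¹` by integration. -/
theorem exists_dual_of_bounded {y : α → ℝ} (hy : Measurable y) {K : ℝ} (hK : 0 ≤ K)
    (hb : ∀ t, |y t| ≤ K) :
    ∃ φ : Lp ℝ 1 μ →L[ℝ] ℝ, ‖φ‖ ≤ K ∧ ∀ f : Lp ℝ 1 μ, φ f = ∫ t, y t * f t ∂μ := by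
  have hbm : BddMeas y := ⟨hy, K, hb⟩
  let L : Lp ℝ 1 μ →ₗ[ℝ] ℝ :=
    { toFun := fun f => ∫ t, y t * f t ∂μ
      map_add' := fun f g => by
        rw [← integral_add (hbm.integrable_mul (L1.integrable_coeFn f))
          (hbm.integrable_mul (L1.integrable_coeFn g))]
        refine integral_congr_ae ?_
        filter_upwards [Lp.coeFn_add f g] with t ht
        rw [ht, Pi.add_apply, mul_add]
      map_smul' := fun c f => by
        rw [RingHom.id_apply, smul_eq_mul, ← integral_const_mul]
        refine integral_congr_ae ?_
        filter_upwards [Lp.coeFn_smul c f] with t ht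
        rw [ht, Pi.smul_apply, smul_eq_mul]
        ring }
  have hL : ∀ f, ‖L f‖ ≤ K * ‖f‖ := fun f => by
    rw [L1.norm_eq_integral_norm, ← integral_const_mul]
    refine norm_integral_le_of_norm_le ((L1.integrable_coeFn f).norm.const_mul K)
      (ae_of_all _ fun t => ?_)
    rw [norm_mul]
    exact mul_le_mul_of_nonneg_right (hb t) (norm_nonneg _)
  exact ⟨L.mkContinuous K hL, L.mkContinuous_norm_le hK hL, fun f => rfl⟩

/-- Every bounded functional on `L¹` of a finite measure is integration against a bounded
function. -/
theorem exists_density [IsFiniteMeasure μ] (φ : Lp ℝ 1 μ →L[ℝ] ℝ) :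
    ∃ y : α → ℝ, Measurable y ∧ (∀ t, |y t| ≤ ‖φ‖) ∧
      ∀ f : Lp ℝ 1 μ, φ f = ∫ t, y t * f t ∂μ := by
  have h21 (f : Lp ℝ 2 μ) : MemLp f 1 μ := (Lp.memLp f).mono_exponent (by norm_num)
  let one2 : Lp ℝ 2 μ := (memLp_const (1 : ℝ)).toLp
  let ι : Lp ℝ 2 μ →L[ℝ] Lp ℝ 1 μ :=
    (ContinuousLinearMap.mul ℝ ℝ).holderL μ 2 2 1 one2
  have hι (f : Lp ℝ 2 μ) : ι f =ᵐ[μ] f := by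
    have h1 := (ContinuousLinearMap.mul ℝ ℝ).coeFn_holder (r := 1) one2 f
    filter_upwards [h1, (memLp_const (1 : ℝ)).coeFn_toLp (μ := μ) (p := 2)] with t ht ht1
    refine ht.trans ?_
    rw [show one2 t = 1 from ht1]
    simp
  let h : Lp ℝ 2 μ := (InnerProductSpace.toDual ℝ (Lp ℝ 2 μ)).symm (φ.comp ι)
  have hh (f : Lp ℝ 2 μ) : inner ℝ h f = φ (ι f) := by
    simp [h]
  have hint : Integrable h μ := memLp_one_iff_integrable.1 (h21 h)
  have hset {s : Set α} (hs : MeasurableSet s) (c : ℝ) :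
      φ (indicatorConstLp 1 hs (measure_ne_top μ s) c) = c * ∫ t in s, h t ∂μ := by
    have h1 : indicatorConstLp 1 hs (measure_ne_top μ s) c
        = ι (indicatorConstLp 2 hs (measure_ne_top μ s) c) := by
      apply Lp.ext
      refine indicatorConstLp_coeFn.trans ?_
      exact (indicatorConstLp_coeFn.symm).trans (hι _).symm
    rw [h1, ← hh, real_inner_comm, L2.inner_indicatorConstLp_eq_setIntegral_inner,
      ← integral_const_mul]
    simp [mul_comm]
  have hbound {s : Set α} (hs : MeasurableSet s) :
      |∫ t in s, h t ∂μ| ≤ ‖φ‖ * μ.real s := by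
    have h1 := φ.le_opNorm (indicatorConstLp 1 hs (measure_ne_top μ s) 1)
    rw [hset hs, norm_indicatorConstLp (by norm_num) (by norm_num)] at h1
    simpa using h1
  have hup : h ≤ᵐ[μ] fun _ => ‖φ‖ := by
    refine ae_le_of_forall_setIntegral_le hint (integrable_const _) fun s hs _ => ?_
    refine (le_abs_self _).trans ((hbound hs).trans ?_)
    simp [mul_comm]
  have hlow : (fun _ => -‖φ‖) ≤ᵐ[μ] h := by
    refine ae_le_of_forall_setIntegral_le (integrable_const _) hint fun s hs _ => ?_
    have := neg_le_of_abs_le (hbound hs)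
    simpa [mul_comm] using this
  have hsm : StronglyMeasurable h := Lp.stronglyMeasurable h
  let y : α → ℝ := fun t => max (-‖φ‖) (min (h t) ‖φ‖)
  have hy : Measurable y := measurable_const.max (hsm.measurable.min measurable_const)
  have hyb : ∀ t, |y t| ≤ ‖φ‖ := fun t =>
    abs_le.2 ⟨le_max_left _ _, max_le (by linarith [norm_nonneg φ]) (min_le_right _ _)⟩
  have hyh : y =ᵐ[μ] h := by
    filter_upwards [hup, hlow] with t h1 h2
    simp only [y]
    rw [min_eq_left h1, max_eq_right h2]
  obtain ⟨ψ, -, hψ⟩ := exists_dual_of_bounded (μ := μ) hy (norm_nonneg φ) hyb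
  refine ⟨y, hy, hyb, fun f => ?_⟩
  rw [← hψ]
  refine Lp.induction (p := 1) (by norm_num) (motive := fun f : Lp ℝ 1 μ => φ f = ψ f)
    (fun c s hs hμ => ?_) (fun f g hf hg _ h1 h2 => ?_) ?_ f
  · rw [Lp.simpleFunc.coe_indicatorConst, hset, hψ, ← integral_const_mul, ← integral_indicator hs]
    refine integral_congr_ae ?_
    filter_upwards [hyh, indicatorConstLp_coeFn (p := 1) (hs := hs) (hμs := hμ.ne) (c := c)]
      with t h1 h2
    rw [h1, h2]
    by_cases ht : t ∈ s <;> simp [ht, mul_comm]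
  · rw [map_add, map_add, h1, h2]
  · exact isClosed_eq φ.continuous ψ.continuous

/-- Bounded functions are compact for the weak-star topology given by pairing with `L¹`. -/
theorem exists_ultrafilter_limit [IsFiniteMeasure μ] {ι : Type*} (U : Ultrafilter ι)
    {v : ι → α → ℝ} {K : ℝ} (hK : 0 ≤ K) (hv : ∀ n, Measurable (v n)) (hb : ∀ n t, |v n t| ≤ K) :
    ∃ w : α → ℝ, Measurable w ∧ (∀ t, |w t| ≤ K) ∧ ∀ f : α → ℝ, Integrable f μ →
      Tendsto (fun n => ∫ t, v n t * f t ∂μ) U (𝓝 (∫ t, w t * f t ∂μ)) := by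
  choose φ hφK hφ using fun n => exists_dual_of_bounded (μ := μ) (hv n) hK (hb n)
  have hc := WeakDual.isCompact_closedBall (𝕜 := ℝ) (E := Lp ℝ 1 μ) 0 K
  obtain ⟨ψ, hψK, hψ⟩ := hc.ultrafilter_le_nhds (U.map fun n => StrongDual.toWeakDual (φ n)) (by
    rw [le_principal_iff]
    refine Ultrafilter.mem_map.2 (Filter.univ_mem' fun n => ?_)
    simpa using hφK n)
  obtain ⟨w, hw, hwb, hwφ⟩ := exists_density (WeakDual.toStrongDual ψ)
  refine ⟨w, hw, fun t => (hwb t).trans (by simpa using hψK), fun f hf => ?_⟩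
  have h1 : Tendsto (fun n => StrongDual.toWeakDual (φ n)) U (𝓝 ψ) := hψ
  have h2 := (WeakDual.eval_continuous (𝕜 := ℝ) (hf.toL1 f)).continuousAt.tendsto.comp h1
  have key (y : α → ℝ) : ∫ t, y t * (hf.toL1 f) t ∂μ = ∫ t, y t * f t ∂μ := by
    refine integral_congr_ae ?_
    filter_upwards [hf.coeFn_toL1] with t ht
    rw [ht]
  rw [← key, ← hwφ]
  refine h2.congr fun n => ?_
  rw [← key, ← hφ]
  rfl

end Duality

instance : IsProbabilityMeasure mu :=
  ⟨by simp [mu]⟩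

instance : NullSingletonClass mu := by
  unfold mu; infer_instance

section Lyapunov

open Classical in
/-- The function equal to `1` on `S` and to `-1` off `S`. -/
noncomputable def signOn {α : Type*} (S : Set α) (t : α) : ℝ := if t ∈ S then 1 else -1

theorem signOn_of_mem {α : Type*} {S : Set α} {t : α} (h : t ∈ S) : signOn S t = 1 := if_pos h

theorem signOn_of_notMem {α : Type*} {S : Set α} {t : α} (h : t ∉ S) : signOn S t = -1 := if_neg h

theorem abs_signOn {α : Type*} (S : Set α) (t : α) : |signOn S t| = 1 := by
  by_cases h : t ∈ S
  · simp [signOn_of_mem h]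
  · simp [signOn_of_notMem h]

theorem BddMeas.signOn {α : Type*} [MeasurableSpace α] {S : Set α} (hS : MeasurableSet S) :
    BddMeas (signOn S) :=
  ⟨by classical exact Measurable.ite hS measurable_const measurable_const,
    1, fun t => (abs_signOn S t).le⟩

theorem integral_mul_toL1 {α : Type*} [MeasurableSpace α] {μ : Measure α} {f : α → ℝ}
    (hf : Integrable f μ) (y : α → ℝ) : ∫ t, y t * hf.toL1 f t ∂μ = ∫ t, y t * f t ∂μ := by
  refine integral_congr_ae ?_
  filter_upwards [hf.coeFn_toL1] with t ht
  rw [ht]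

/-- On a set of positive measure there is a nonzero bounded function annihilated by finitely many
given bounded functions. -/
theorem exists_bddMeas_annihilated {ι : Type*} [Finite ι] {u : ι → ℝ → ℝ}
    (hu : ∀ i, BddMeas (u i)) {F : Set ℝ} (hF : MeasurableSet F) (hpos : mu F ≠ 0) :
    ∃ k : ℝ → ℝ, BddMeas k ∧ (∀ t ∉ F, k t = 0) ∧ (∀ i, ∫ t, k t * u i t ∂mu = 0) ∧
      ¬ k =ᵐ[mu] 0 := by
  have := Fintype.ofFinite ι
  let G : Set ℝ := F ∩ Set.Icc 0 1
  have hG : MeasurableSet G := hF.inter measurableSet_Icc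
  have hb (p : Polynomial ℝ) : BddMeas (G.indicator fun t => p.eval t) := by
    obtain ⟨K, hK⟩ := (isCompact_Icc (a := (0 : ℝ)) (b := 1)).exists_bound_of_continuousOn
      p.continuous.continuousOn
    refine ⟨p.continuous.measurable.indicator hG, |K|, fun t => ?_⟩
    by_cases ht : t ∈ G
    · simpa [ht] using (hK t ht.2).trans (le_abs_self K)
    · simp [ht]
  let L : Polynomial ℝ →ₗ[ℝ] (ι → ℝ) :=
    { toFun := fun p i => ∫ t, G.indicator (fun t => p.eval t) t * u i t ∂mu
      map_add' := fun p q => by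
        funext i
        rw [Pi.add_apply, ← integral_add (((hb p).mul (hu i)).integrable)
          (((hb q).mul (hu i)).integrable)]
        congr 1
        funext t
        by_cases ht : t ∈ G <;> simp [ht, add_mul]
      map_smul' := fun c p => by
        funext i
        rw [Pi.smul_apply, RingHom.id_apply, smul_eq_mul, ← integral_const_mul]
        congr 1
        funext t
        by_cases ht : t ∈ G <;> simp [ht, mul_assoc] }
  have hni : ¬ Function.Injective L := fun h => by
    have := FiniteDimensional.of_injective L h
    exact Polynomial.not_finite (R := ℝ) this
  obtain ⟨p, hp0, hp⟩ : ∃ p, L p = 0 ∧ p ≠ 0 := by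
    by_contra! hcon
    exact hni ((injective_iff_map_eq_zero L).2 hcon)
  refine ⟨G.indicator fun t => p.eval t, hb p, fun t ht => by simp [G, ht],
    fun i => congrFun hp0 i, fun h0 => hpos ?_⟩
  have hroots : mu (p.rootSet ℝ) = 0 := (p.rootSet_finite ℝ).measure_zero mu
  have hI : ∀ᵐ t ∂mu, t ∈ Set.Icc (0 : ℝ) 1 := ae_restrict_mem measurableSet_Icc
  have hr : ∀ᵐ t ∂mu, t ∉ p.rootSet ℝ := measure_eq_zero_iff_ae_notMem.1 hroots
  rw [measure_eq_zero_iff_ae_notMem]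
  filter_upwards [h0, hI, hr] with t h1 h2 h3 h4
  apply h3
  rw [Polynomial.mem_rootSet]
  refine ⟨hp, ?_⟩
  simpa [show t ∈ G from ⟨h4, h2⟩] using h1

/-- A form of Lyapunov's convexity theorem: finitely many integrals of a function with values in
`[-1, 1]` are reproduced by a function with values in `{-1, 1}`. -/
theorem exists_signOn_integral_eq {ι : Type*} [Finite ι] {u : ι → ℝ → ℝ}
    (hu : ∀ i, BddMeas (u i)) {g : ℝ → ℝ} (hg : Measurable g) (hg1 : ∀ t, |g t| ≤ 1) :
    ∃ S : Set ℝ, MeasurableSet S ∧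
      ∀ i, ∫ t, signOn S t * u i t ∂mu = ∫ t, g t * u i t ∂mu := by
  have hint i : Integrable (u i) mu := (hu i).integrable
  let W : Set (WeakDual ℝ (Lp ℝ 1 mu)) :=
    (WeakDual.toStrongDual ⁻¹' Metric.closedBall 0 1) ∩
      ⋂ i, {ψ | ψ ((hint i).toL1 (u i)) = ∫ t, g t * u i t ∂mu}
  have hWc : IsCompact W := (WeakDual.isCompact_closedBall 0 1).inter_right
    (isClosed_iInter fun i => isClosed_eq (WeakDual.eval_continuous _) continuous_const)
  have memW {y : ℝ → ℝ} (hy : Measurable y) (hy1 : ∀ t, |y t| ≤ 1)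
      (hyi : ∀ i, ∫ t, y t * u i t ∂mu = ∫ t, g t * u i t ∂mu) :
      ∃ ψ ∈ W, ∀ f : Lp ℝ 1 mu, ψ f = ∫ t, y t * f t ∂mu := by
    obtain ⟨φ, hφ1, hφ⟩ := exists_dual_of_bounded (μ := mu) hy zero_le_one hy1
    refine ⟨StrongDual.toWeakDual φ, ⟨by simpa using hφ1, Set.mem_iInter.2 fun i => ?_⟩, hφ⟩
    exact (hφ _).trans ((integral_mul_toL1 (hint i) y).trans (hyi i))
  obtain ⟨ψ0, hψ0, -⟩ := memW hg hg1 fun i => rfl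
  have := (WeakDual.withSeminorms ℝ (Lp ℝ 1 mu)).toLocallyConvexSpace
  obtain ⟨ψ, hψ⟩ := hWc.extremePoints_nonempty ⟨ψ0, hψ0⟩
  obtain ⟨h, hh, hhb, hhψ⟩ := exists_density (WeakDual.toStrongDual ψ)
  have hψ1 : ‖WeakDual.toStrongDual ψ‖ ≤ 1 := by simpa using hψ.1.1
  have hh1 t : |h t| ≤ 1 := (hhb t).trans hψ1
  have hhi i : ∫ t, h t * u i t ∂mu = ∫ t, g t * u i t ∂mu := by
    rw [← integral_mul_toL1 (hint i), ← hhψ]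
    exact Set.mem_iInter.1 hψ.1.2 i
  have hnull (n : ℕ) : mu {t | |h t| ≤ 1 - 1 / ((n : ℝ) + 1)} = 0 := by
    by_contra hne
    obtain ⟨k, hk, hkF, hki, hk0⟩ := exists_bddMeas_annihilated hu
      (measurableSet_le hh.abs measurable_const) hne
    obtain ⟨hkm, K, hK⟩ := id hk
    have hε : 0 < 1 / ((n : ℝ) + 1) := by positivity
    have hKpos : 0 < |K| + 1 := by positivity
    set δ : ℝ := 1 / ((n : ℝ) + 1) / (|K| + 1) with hδ
    have hδpos : 0 < δ := by positivity
    have hδk t : |δ * k t| ≤ 1 / ((n : ℝ) + 1) := by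
      rw [abs_mul, abs_of_pos hδpos]
      calc δ * |k t| ≤ δ * (|K| + 1) := by
            gcongr
            exact (hK t).trans ((le_abs_self K).trans (by linarith))
        _ = _ := by rw [hδ]; field_simp
    have hpert (σ : ℝ) (hσ : |σ| = 1) :
        ∃ χ ∈ W, ∀ f : Lp ℝ 1 mu, χ f = ∫ t, (h t + σ * (δ * k t)) * f t ∂mu := by
      refine memW (hh.add ((hkm.const_mul δ).const_mul σ)) (fun t => ?_) fun i => ?_
      · by_cases ht : |h t| ≤ 1 - 1 / ((n : ℝ) + 1)
        · calc |h t + σ * (δ * k t)| ≤ |h t| + |σ * (δ * k t)| := abs_add_le _ _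
            _ ≤ 1 := by
              rw [abs_mul, hσ, one_mul]
              linarith [hδk t]
        · rw [hkF t ht]
          simpa using hh1 t
      · have h1 : Integrable (fun t => h t * u i t) mu :=
          (BddMeas.mul ⟨hh, 1, hh1⟩ (hu i)).integrable
        have h2 : Integrable (fun t => k t * u i t) mu := (hk.mul (hu i)).integrable
        rw [← hhi i, ← add_zero (∫ t, h t * u i t ∂mu), ← mul_zero (σ * δ), ← hki i,
          ← integral_const_mul, ← integral_add h1 (h2.const_mul _)]
        congr 1
        funext t
        ring
    obtain ⟨χ₁, hχ₁, hχ₁f⟩ := hpert 1 (by simp)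
    obtain ⟨χ₂, hχ₂, hχ₂f⟩ := hpert (-1) (by simp)
    have hseg : ψ ∈ openSegment ℝ χ₁ χ₂ := by
      refine ⟨1 / 2, 1 / 2, by norm_num, by norm_num, by norm_num, ?_⟩
      refine DFunLike.ext _ _ fun f => ?_
      have e : ((1 / 2 : ℝ) • χ₁ + (1 / 2 : ℝ) • χ₂) f = 1 / 2 * χ₁ f + 1 / 2 * χ₂ f := rfl
      rw [e, hχ₁f, hχ₂f, ← integral_const_mul, ← integral_const_mul]
      have hf := L1.integrable_coeFn f
      have hb (σ : ℝ) : BddMeas fun t => h t + σ * (δ * k t) :=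
        BddMeas.add ⟨hh, 1, hh1⟩ ((hk.const_mul δ).const_mul σ)
      rw [← integral_add (((hb 1).integrable_mul hf).const_mul _)
        (((hb (-1)).integrable_mul hf).const_mul _)]
      refine Eq.trans ?_ (hhψ f).symm
      congr 1
      funext t
      ring
    have heq : χ₁ = ψ := hψ.2 hχ₁ hχ₂ hseg
    have hkk : ∫ t, k t * k t ∂mu = 0 := by
      have h1 := hχ₁f (hk.integrable.toL1 k)
      rw [heq, integral_mul_toL1 hk.integrable] at h1
      have h2 := hhψ (hk.integrable.toL1 k)
      rw [integral_mul_toL1 hk.integrable] at h2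
      have h3 : ∫ t, (h t + 1 * (δ * k t)) * k t ∂mu
          = (∫ t, h t * k t ∂mu) + δ * ∫ t, k t * k t ∂mu := by
        rw [← integral_const_mul, ← integral_add
          (BddMeas.mul ⟨hh, 1, hh1⟩ hk).integrable ((hk.mul hk).integrable.const_mul _)]
        congr 1
        funext t
        ring
      have h4 : δ * ∫ t, k t * k t ∂mu = 0 := by
        have h5 : ψ (hk.integrable.toL1 k) = ∫ t, h t * k t ∂mu := h2
        linarith
      exact (mul_eq_zero.1 h4).resolve_left hδpos.ne'
    apply hk0
    have := (integral_eq_zero_iff_of_nonneg (fun t => mul_self_nonneg (k t))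
      (hk.mul hk).integrable).1 hkk
    filter_upwards [this] with t ht
    simpa using ht
  refine ⟨{t | 0 ≤ h t}, measurableSet_le measurable_const hh, fun i => ?_⟩
  rw [← hhi i]
  refine integral_congr_ae ?_
  have hall : ∀ᵐ t ∂mu, ∀ n : ℕ, t ∉ {t | |h t| ≤ 1 - 1 / ((n : ℝ) + 1)} :=
    ae_all_iff.2 fun n => measure_eq_zero_iff_ae_notMem.1 (hnull n)
  filter_upwards [hall] with t ht
  have habs : |h t| = 1 := by
    refine le_antisymm (hh1 t) (le_of_forall_pos_sub_le fun ε hε => ?_)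
    obtain ⟨n, hn⟩ := exists_nat_one_div_lt hε
    have := not_le.1 (ht n)
    linarith
  congr 1
  rcases abs_choice (h t) with h0 | h0
  · have h1 : h t = 1 := by rw [← h0, habs]
    rw [signOn_of_mem (by simp [h1]), h1]
  · have h1 : h t = -1 := by linarith
    rw [signOn_of_notMem (by simp [h1]), h1]

end Lyapunov

section WeaklyNull

theorem signOn_mul_self {α : Type*} (z : α → ℝ) (t : α) : signOn {t | 0 ≤ z t} t * z t = |z t| := by
  by_cases h : 0 ≤ z t
  · rw [signOn_of_mem (S := {t | 0 ≤ z t}) h, one_mul, abs_of_nonneg h]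
  · rw [signOn_of_notMem (S := {t | 0 ≤ z t}) h, abs_of_neg (not_le.1 h), neg_one_mul]

variable {α : Type*} [MeasurableSpace α] {μ : Measure α}

theorem isClosed_abs_le_one_inter {ι : Type*} (z : ι → Lp ℝ 1 μ) (ε : ℝ) :
    IsClosed {g : Lp ℝ 1 μ | (∀ᵐ t ∂μ, |g t| ≤ 1) ∧ ∀ i, |∫ t, g t * z i t ∂μ| ≤ ε} := by
  refine IsSeqClosed.isClosed fun g g₀ hg hlim => ?_
  obtain ⟨ns, -, hns⟩ := (tendstoInMeasure_of_tendsto_Lp hlim).exists_seq_tendsto_ae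
  have hall : ∀ᵐ t ∂μ, ∀ k, |g k t| ≤ 1 := ae_all_iff.2 fun k => (hg k).1
  refine ⟨?_, fun i => ?_⟩
  · filter_upwards [hall, hns] with t h1 h2
    exact le_of_tendsto' h2.abs fun k => h1 (ns k)
  · have hDCT : Tendsto (fun k => ∫ t, g (ns k) t * z i t ∂μ) atTop
        (𝓝 (∫ t, g₀ t * z i t ∂μ)) := by
      refine tendsto_integral_of_dominated_convergence (fun t => ‖z i t‖)
        (fun k => (Lp.aestronglyMeasurable _).mul (Lp.aestronglyMeasurable _))
        (L1.integrable_coeFn (z i)).norm (fun k => ?_) ?_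
      · filter_upwards [hall] with t ht
        rw [norm_mul]
        exact mul_le_of_le_one_left (norm_nonneg _) (ht (ns k))
      · filter_upwards [hns] with t ht
        exact ht.mul_const _
    exact le_of_tendsto' hDCT.abs fun k => (hg (ns k)).2 i

/-- A sequence in `L¹` whose integrals against every bounded function tend to zero is
equi-integrable (the Dunford-Pettis criterion). -/
theorem equiintegrable_of_weakly_null [IsFiniteMeasure μ] {z : ℕ → Lp ℝ 1 μ}
    (hz : ∀ g : α → ℝ, BddMeas g → Tendsto (fun n => ∫ t, g t * z n t ∂μ) atTop (𝓝 0))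
    {ε : ℝ} (hε : 0 < ε) :
    ∃ η > 0, ∃ N, ∀ n ≥ N, ∀ A, MeasurableSet A → μ.real A < η → ∫ t in A, |z n t| ∂μ ≤ ε := by
  let B : Set (Lp ℝ 1 μ) := {g | ∀ᵐ t ∂μ, |g t| ≤ 1}
  have hB : IsClosed B := by
    simpa [B] using isClosed_abs_le_one_inter (fun i : Empty => (i.elim : Lp ℝ 1 μ)) 0
  let C (N : ℕ) : Set (Lp ℝ 1 μ) :=
    {g | (∀ᵐ t ∂μ, |g t| ≤ 1) ∧ ∀ i : Set.Ici N, |∫ t, g t * z i t ∂μ| ≤ ε / 2}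
  have hC N : IsClosed (C N) := isClosed_abs_le_one_inter (fun i : Set.Ici N => z i) (ε / 2)
  have : CompleteSpace B := hB.completeSpace_coe
  have : Nonempty B := ⟨0, by
    filter_upwards [Lp.coeFn_zero ℝ 1 μ] with t ht
    rw [ht]
    simp⟩
  obtain ⟨N, g₀, hg₀⟩ := nonempty_interior_of_iUnion_of_closed
    (f := fun N => ((↑) : B → Lp ℝ 1 μ) ⁻¹' C N) (fun N => (hC N).preimage continuous_subtype_val)
    (by
      refine Set.eq_univ_of_forall fun g => Set.mem_iUnion.2 ?_
      have hgm := (Lp.stronglyMeasurable g.1).measurable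
      let g' : α → ℝ := fun t => max (-1) (min (g.1 t) 1)
      have hg' : BddMeas g' := ⟨measurable_const.max (hgm.min measurable_const), 1, fun t =>
        abs_le.2 ⟨le_max_left _ _, max_le (by norm_num) (min_le_right _ _)⟩⟩
      have hgg' : g' =ᵐ[μ] g.1 := by
        filter_upwards [g.2] with t ht
        simp only [g']
        rw [min_eq_left (abs_le.1 ht).2, max_eq_right (abs_le.1 ht).1]
      obtain ⟨N, hN⟩ := eventually_atTop.1
        ((hz g' hg').abs.eventually_le_const (u := ε / 2) (by simpa using half_pos hε))
      refine ⟨N, g.2, fun i => le_of_eq_of_le ?_ (hN i i.2)⟩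
      congr 1
      refine integral_congr_ae ?_
      filter_upwards [hgg'] with t ht
      rw [ht])
  rw [mem_interior_iff_mem_nhds, Metric.mem_nhds_iff] at hg₀
  obtain ⟨r, hr, hball⟩ := hg₀
  refine ⟨r / 2, half_pos hr, N, fun n hn A hA hμA => ?_⟩
  have hg₀m := (Lp.stronglyMeasurable g₀.1).measurable
  have hzm := (Lp.stronglyMeasurable (z n)).measurable
  have key (v : α → ℝ) (hv : Measurable v) (hv1 : ∀ t, |v t| ≤ 1) :
      Integrable (fun t => A.indicator v t * z n t + Aᶜ.indicator g₀.1 t * z n t) μ ∧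
      |∫ t, (A.indicator v t * z n t + Aᶜ.indicator g₀.1 t * z n t) ∂μ| ≤ ε / 2 := by
    let q : α → ℝ := fun t => A.indicator v t + Aᶜ.indicator g₀.1 t
    have hqm : Measurable q := (hv.indicator hA).add (hg₀m.indicator hA.compl)
    have hq1 : ∀ᵐ t ∂μ, |q t| ≤ 1 := by
      filter_upwards [g₀.2] with t ht
      by_cases h : t ∈ A
      · simpa [q, h] using hv1 t
      · simpa [q, h] using ht
    have hqi : Integrable q μ := (integrable_const (1 : ℝ)).mono' hqm.aestronglyMeasurable hq1
    have hqz : Integrable (fun t => q t * z n t) μ :=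
      (L1.integrable_coeFn (z n)).bdd_mul hqm.aestronglyMeasurable (c := 1) hq1
    have hqB : hqi.toL1 q ∈ B := by
      filter_upwards [hqi.coeFn_toL1, hq1] with t h1 h2
      rwa [h1]
    have hdist : dist (⟨hqi.toL1 q, hqB⟩ : B) g₀ < r := by
      rw [Subtype.dist_eq, L1.dist_eq_integral_dist]
      calc ∫ t, dist (hqi.toL1 q t) (g₀.1 t) ∂μ ≤ ∫ t, A.indicator (fun _ => (2 : ℝ)) t ∂μ := by
            refine integral_mono_ae ?_ ((integrable_const _).indicator hA) ?_
            · simpa [dist_eq_norm] using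
                ((L1.integrable_coeFn (hqi.toL1 q)).sub (L1.integrable_coeFn g₀.1)).norm
            · filter_upwards [hqi.coeFn_toL1, g₀.2] with t h1 h2
              rw [h1]
              by_cases h : t ∈ A
              · simp only [q, h, Set.indicator_of_mem, Set.mem_compl_iff, not_true_eq_false,
                  not_false_eq_true, Set.indicator_of_notMem, add_zero, Real.dist_eq]
                calc |v t - g₀.1 t| ≤ |v t| + |g₀.1 t| := abs_sub _ _
                  _ ≤ 2 := by linarith [hv1 t]
              · simp [q, h]
        _ = 2 * μ.real A := by
            rw [integral_indicator hA, setIntegral_const, smul_eq_mul, mul_comm]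
        _ < r := by linarith
    have h1 := (hball (Metric.mem_ball.2 hdist)).2 ⟨n, hn⟩
    have h2 : ∫ t, hqi.toL1 q t * z n t ∂μ
        = ∫ t, (A.indicator v t * z n t + Aᶜ.indicator g₀.1 t * z n t) ∂μ := by
      refine integral_congr_ae ?_
      filter_upwards [hqi.coeFn_toL1] with t h1
      rw [h1, ← add_mul]
    refine ⟨hqz.congr (ae_of_all _ fun t => ?_), h2 ▸ h1⟩
    exact add_mul _ _ _
  have hS : MeasurableSet {t | 0 ≤ z n t} := measurableSet_le measurable_const hzm
  obtain ⟨i1, b1⟩ := key (signOn {t | 0 ≤ z n t}) (BddMeas.signOn hS).measurable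
    fun t => (abs_signOn _ t).le
  obtain ⟨i2, b2⟩ := key (fun _ => 0) measurable_const (by simp)
  have h3 : ∫ t in A, |z n t| ∂μ
      = (∫ t, (A.indicator (signOn {t | 0 ≤ z n t}) t * z n t + Aᶜ.indicator g₀.1 t * z n t) ∂μ)
        - ∫ t, (A.indicator (fun _ => (0 : ℝ)) t * z n t + Aᶜ.indicator g₀.1 t * z n t) ∂μ := by
    rw [← integral_sub i1 i2, ← integral_indicator hA]
    congr 1
    funext t
    by_cases h : t ∈ A
    · simp [h, signOn_mul_self]
    · simp [h]
  rw [h3]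
  linarith [(abs_le.1 b1).2, (abs_le.1 b2).1]

end WeaklyNull

section Correlated

/-- Weakly null sequences are bounded. -/
theorem exists_norm_bound_of_weakly_null {E : Type*} [NormedAddCommGroup E] [NormedSpace ℝ E]
    {z : ℕ → E} (hz : ∀ φ : E →L[ℝ] ℝ, Tendsto (fun n => φ (z n)) atTop (𝓝 0)) :
    ∃ M, ∀ n, ‖z n‖ ≤ M := by
  obtain ⟨M, hM⟩ := banach_steinhaus (g := fun n => NormedSpace.inclusionInDoubleDual ℝ E (z n))
    fun φ => by
      obtain ⟨C, hC⟩ := (hz φ).norm.bddAbove_range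
      exact ⟨C, fun n => hC ⟨n, rfl⟩⟩
  exact ⟨M, fun n => by
    simpa using ((NormedSpace.inclusionInDoubleDualLi ℝ (E := E)).norm_map (z n)).symm.trans_le
      (hM n)⟩

/-- Banach-Alaoglu along an ultrafilter. -/
theorem exists_dual_ultrafilter_limit {E : Type*} [NormedAddCommGroup E] [NormedSpace ℝ E]
    {ι : Type*} (U : Ultrafilter ι) {x : ι → E →L[ℝ] ℝ} {K : ℝ} (hx : ∀ n, ‖x n‖ ≤ K) :
    ∃ ξ : E →L[ℝ] ℝ, ‖ξ‖ ≤ K ∧ ∀ v, Tendsto (fun n => x n v) U (𝓝 (ξ v)) := by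
  obtain ⟨ψ, hψK, hψ⟩ := (WeakDual.isCompact_closedBall (𝕜 := ℝ) (E := E) 0 K).ultrafilter_le_nhds
    (U.map fun n => StrongDual.toWeakDual (x n)) (by
      rw [le_principal_iff]
      refine Ultrafilter.mem_map.2 (Filter.univ_mem' fun n => ?_)
      simpa using hx n)
  have h1 : Tendsto (fun n => StrongDual.toWeakDual (x n)) U (𝓝 ψ) := hψ
  exact ⟨WeakDual.toStrongDual ψ, by simpa using hψK, fun v =>
    (WeakDual.eval_continuous (𝕜 := ℝ) v).continuousAt.tendsto.comp h1⟩

/-- An operator on `L¹` which is not completely continuous is bounded below on a uniformly bounded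
weak-star null family of functions. -/
theorem exists_bounded_null_family {X : Type*} [NormedAddCommGroup X] [NormedSpace ℝ X]
    {T : Lp ℝ 1 mu →L[ℝ] X} (hT : ¬ CompletelyContinuous T) :
    ∃ (U : Ultrafilter ℕ) (w : ℕ → ℝ → ℝ) (W : ℕ → Lp ℝ 1 mu) (δ : ℝ), 0 < δ ∧
      (∀ n, Measurable (w n)) ∧ (∀ n t, |w n t| ≤ 1) ∧
      (∀ f : ℝ → ℝ, Integrable f mu → Tendsto (fun n => ∫ t, w n t * f t ∂mu) U (𝓝 0)) ∧
      (∀ n, W n =ᵐ[mu] w n) ∧ ∀ᶠ n in U, δ ≤ ‖T (W n)‖ := by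
  simp only [CompletelyContinuous, not_forall] at hT
  obtain ⟨x, x₀, hx, hTx⟩ := hT
  let z (n : ℕ) : Lp ℝ 1 mu := x n - x₀
  have hz (φ : Lp ℝ 1 mu →L[ℝ] ℝ) : Tendsto (fun n => φ (z n)) atTop (𝓝 0) := by
    simpa [z] using (hx φ).sub_const (φ x₀)
  obtain ⟨δ, hδ, hfreq⟩ : ∃ δ > 0, ∃ᶠ n in atTop, δ ≤ ‖T (z n)‖ := by
    rw [Metric.tendsto_nhds] at hTx
    push Not at hTx
    obtain ⟨δ, hδ, h⟩ := hTx
    refine ⟨δ, hδ, h.mono fun n hn => ?_⟩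
    simpa [z, dist_eq_norm] using hn
  have : NeBot (atTop ⊓ 𝓟 {n | δ ≤ ‖T (z n)‖}) := frequently_mem_iff_neBot.1 hfreq
  let U : Ultrafilter ℕ := Ultrafilter.of (atTop ⊓ 𝓟 {n | δ ≤ ‖T (z n)‖})
  have hUtop : (U : Filter ℕ) ≤ atTop := (Ultrafilter.of_le _).trans inf_le_left
  have hUδ : ∀ᶠ n in U, δ ≤ ‖T (z n)‖ :=
    ((Ultrafilter.of_le _).trans inf_le_right) (mem_principal_self _)
  obtain ⟨M, hM⟩ := exists_norm_bound_of_weakly_null hz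
  have hM0 : 0 ≤ M := (norm_nonneg _).trans (hM 0)
  have hzb (g : ℝ → ℝ) (hg : BddMeas g) :
      Tendsto (fun n => ∫ t, g t * z n t ∂mu) atTop (𝓝 0) := by
    obtain ⟨hgm, K, hK⟩ := hg
    obtain ⟨φ, -, hφ⟩ := exists_dual_of_bounded (μ := mu) hgm (abs_nonneg K)
      fun t => (hK t).trans (le_abs_self K)
    simpa only [hφ] using hz φ
  set ε : ℝ := δ / (4 * (‖T‖ + 1)) with hεdef
  have hT1 : 0 < ‖T‖ + 1 := by positivity
  have hε : 0 < ε := by positivity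
  have hTε : ‖T‖ * ε ≤ δ / 4 := by
    have : (‖T‖ + 1) * ε = δ / 4 := by rw [hεdef]; field_simp
    nlinarith
  obtain ⟨η, hη, N, hN⟩ := equiintegrable_of_weakly_null hzb hε
  set K : ℝ := M / η + 1 with hKdef
  have hK : 0 < K := by positivity
  have hMK : M < K * η := by rw [hKdef, add_mul, div_mul_cancel₀ _ hη.ne']; linarith
  have hzm n : Measurable (z n) := (Lp.stronglyMeasurable (z n)).measurable
  let A (n : ℕ) : Set ℝ := {t | K ≤ |z n t|}
  have hA n : MeasurableSet (A n) := measurableSet_le measurable_const (hzm n).abs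
  have hAη n : mu.real (A n) < η := by
    have h1 := mul_meas_ge_le_integral_of_nonneg (μ := mu) (f := fun t => |z n t|)
      (ae_of_all _ fun t => abs_nonneg _) (L1.integrable_coeFn (z n)).abs K
    have h2 : ∫ t, |z n t| ∂mu ≤ M := by
      refine le_trans (le_of_eq ?_) (hM n)
      rw [L1.norm_eq_integral_norm]
      rfl
    have h3 : K * mu.real (A n) < K * η := (h1.trans h2).trans_lt hMK
    exact lt_of_mul_lt_mul_left h3 hK.le
  let v (n : ℕ) : ℝ → ℝ := (A n)ᶜ.indicator (z n)
  have hvm n : Measurable (v n) := (hzm n).indicator (hA n).compl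
  have hvK n t : |v n t| ≤ K := by
    by_cases h : t ∈ A n
    · simpa [v, h] using hK.le
    · have h' : ¬ K ≤ |z n t| := h
      simpa [v, h] using (not_le.1 h').le
  have hvb n : BddMeas (v n) := ⟨hvm n, K, hvK n⟩
  have hzv n (hn : N ≤ n) : ∫ t, |z n t - v n t| ∂mu ≤ ε := by
    refine le_trans (le_of_eq ?_) (hN n hn (A n) (hA n) (hAη n))
    rw [← integral_indicator (hA n)]
    congr 1
    funext t
    by_cases h : t ∈ A n <;> simp [v, h]
  obtain ⟨w, hwm, hwK, hw⟩ := exists_ultrafilter_limit (μ := mu) U hK.le hvm hvK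
  have hwb : BddMeas w := ⟨hwm, K, hwK⟩
  have hwε : ∫ t, |w t| ∂mu ≤ ε := by
    let s : ℝ → ℝ := signOn {t | 0 ≤ w t}
    have hs : BddMeas s := BddMeas.signOn (measurableSet_le measurable_const hwm)
    have h1 := hw s hs.integrable
    have h2 := ((hzb s hs).mono_left hUtop).add_const ε
    rw [zero_add] at h2
    have h3 : ∀ᶠ n in U, ∫ t, v n t * s t ∂mu ≤ (∫ t, s t * z n t ∂mu) + ε := by
      filter_upwards [hUtop (eventually_ge_atTop N)] with n hn
      have i1 := hs.integrable_mul (L1.integrable_coeFn (z n))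
      have i2 : Integrable (fun t => |z n t - v n t|) mu :=
        ((L1.integrable_coeFn (z n)).sub (hvb n).integrable).abs
      refine le_trans ?_ (add_le_add_right (hzv n hn) _)
      rw [← integral_add i1 i2]
      refine integral_mono ((hvb n).mul hs).integrable (i1.add i2) fun t => ?_
      have h4 : |(v n t - z n t) * s t| ≤ |z n t - v n t| := by
        rw [abs_mul, abs_signOn, mul_one, abs_sub_comm]
      have h5 := (le_abs_self _).trans h4
      linarith
    have h6 := le_of_tendsto_of_tendsto h1 h2 h3
    refine le_trans (le_of_eq ?_) h6
    congr 1
    funext t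
    rw [mul_comm, signOn_mul_self]
  have h2K : (0 : ℝ) < (2 * K)⁻¹ := by positivity
  refine ⟨U, fun n t => (2 * K)⁻¹ * (v n t - w t),
    fun n => (2 * K)⁻¹ • ((hvb n).integrable.toL1 (v n) - hwb.integrable.toL1 w),
    (2 * K)⁻¹ * (δ / 2), by positivity, fun n => ((hvm n).sub hwm).const_mul _, fun n t => ?_,
    fun f hf => ?_, fun n => ?_, ?_⟩
  · rw [abs_mul, abs_of_pos h2K, inv_mul_le_iff₀ (by positivity)]
    have := abs_sub (v n t) (w t)
    linarith [hvK n t, hwK t]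
  · have h1 := ((hw f hf).sub_const (∫ t, w t * f t ∂mu)).const_mul (2 * K)⁻¹
    rw [sub_self, mul_zero] at h1
    refine h1.congr fun n => ?_
    rw [← integral_sub ((hvb n).integrable_mul hf) (hwb.integrable_mul hf), ← integral_const_mul]
    congr 1
    funext t
    ring
  · filter_upwards [Lp.coeFn_smul (2 * K)⁻¹
      ((hvb n).integrable.toL1 (v n) - hwb.integrable.toL1 w),
      Lp.coeFn_sub ((hvb n).integrable.toL1 (v n)) (hwb.integrable.toL1 w),
      (hvb n).integrable.coeFn_toL1, hwb.integrable.coeFn_toL1] with t h1 h2 h3 h4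
    rw [h1, Pi.smul_apply, h2, Pi.sub_apply, h3, h4, smul_eq_mul]
  · filter_upwards [hUδ, hUtop (eventually_ge_atTop N)] with n hn hnN
    rw [map_smul, norm_smul, Real.norm_of_nonneg h2K.le]
    refine mul_le_mul_of_nonneg_left ?_ h2K.le
    set V : Lp ℝ 1 mu := (hvb n).integrable.toL1 (v n)
    set W : Lp ℝ 1 mu := hwb.integrable.toL1 w
    have h1 : T (z n) = T (V - W) + T (z n - V) + T W := by
      rw [← map_add, ← map_add]
      congr 1
      abel
    have h2 : ‖z n - V‖ ≤ ε := by
      refine le_trans (le_of_eq ?_) (hzv n hnN)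
      rw [L1.norm_eq_integral_norm]
      refine integral_congr_ae ?_
      filter_upwards [Lp.coeFn_sub (z n) V, ((hvb n).integrable (μ := mu)).coeFn_toL1] with t h3 h4
      rw [h3, Pi.sub_apply, h4, Real.norm_eq_abs]
    have h3 : ‖W‖ ≤ ε := by
      refine le_trans (le_of_eq ?_) hwε
      rw [L1.norm_eq_integral_norm]
      refine integral_congr_ae ?_
      filter_upwards [(hwb.integrable (μ := mu)).coeFn_toL1] with t h4
      rw [h4, Real.norm_eq_abs]
    have h4 : ‖T (z n)‖ ≤ ‖T (V - W)‖ + ‖T (z n - V)‖ + ‖T W‖ := h1 ▸ norm_add₃_le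
    have h5 := T.le_opNorm_of_le h2
    have h6 := T.le_opNorm_of_le h3
    linarith

/-- If `T` is not completely continuous, there are a uniformly bounded weak-star null family of
functions `w n` and a bounded weak-star null family of functionals `x n` for which the products
of `w n` with the densities `y n` of `x n ∘ T` are bounded below on average on a set `E`. -/
theorem exists_correlated_families {X : Type*} [NormedAddCommGroup X] [NormedSpace ℝ X]
    {T : Lp ℝ 1 mu →L[ℝ] X} (hT : ¬ CompletelyContinuous T) :
    ∃ (U : Ultrafilter ℕ) (w y : ℕ → ℝ → ℝ) (x : ℕ → X →L[ℝ] ℝ) (E : Set ℝ) (c : ℝ),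
      (∀ n, Measurable (w n)) ∧ (∀ n t, |w n t| ≤ 1) ∧
      (∀ f : ℝ → ℝ, Integrable f mu → Tendsto (fun n => ∫ t, w n t * f t ∂mu) U (𝓝 0)) ∧
      (∀ n, ‖x n‖ ≤ 2) ∧ (∀ v, Tendsto (fun n => x n v) U (𝓝 0)) ∧ (∀ n, BddMeas (y n)) ∧
      (∀ n (f : Lp ℝ 1 mu), x n (T f) = ∫ t, y n t * f t ∂mu) ∧
      MeasurableSet E ∧ 0 < mu.real E ∧ 0 < c ∧
      ∀ B ⊆ E, MeasurableSet B → 0 < mu.real B →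
        ∀ᶠ n in U, c * mu.real B ≤ ∫ t in B, y n t * w n t ∂mu := by
  obtain ⟨U, w, W, δ, hδ, hwm, hw1, hw, hWw, hWδ⟩ := exists_bounded_null_family hT
  choose ξ' hξ_norm hξ' using fun n => exists_dual_vector'' ℝ (T (W n))
  obtain ⟨ξ, hξ1, hξ⟩ := exists_dual_ultrafilter_limit U hξ_norm
  let x (n : ℕ) : X →L[ℝ] ℝ := ξ' n - ξ
  have hx2 n : ‖x n‖ ≤ 2 := (norm_sub_le _ _).trans (by linarith [hξ_norm n])
  choose y hym hyb hy using fun n => exists_density ((x n).comp T)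
  have hyC n t : |y n t| ≤ 2 * ‖T‖ := (hyb n t).trans
    (((x n).opNorm_comp_le T).trans (mul_le_mul_of_nonneg_right (hx2 n) (norm_nonneg T)))
  have hybm n : BddMeas (y n) := ⟨hym n, _, hyC n⟩
  have hwbm n : BddMeas (w n) := ⟨hwm n, _, hw1 n⟩
  obtain ⟨h, hhm, hhb, hh⟩ := exists_ultrafilter_limit (μ := mu) (K := 2 * ‖T‖) U (by positivity)
    (fun n => (hym n).mul (hwm n)) (fun n t => by
      rw [Pi.mul_apply, abs_mul]
      exact (mul_le_of_le_one_right (abs_nonneg _) (hw1 n t)).trans (hyC n t))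
  have hhbm : BddMeas h := ⟨hhm, _, hhb⟩
  have hhδ : δ ≤ ∫ t, h t ∂mu := by
    have h1 : Tendsto (fun n => ∫ t, y n t * w n t ∂mu) U (𝓝 (∫ t, h t ∂mu)) := by
      simpa using hh (fun _ => 1) (integrable_const _)
    obtain ⟨q, hqm, hqb, hq⟩ := exists_density (ξ.comp T)
    have h2 := hw q (BddMeas.integrable ⟨hqm, _, hqb⟩)
    have h3 : Tendsto (fun n => (∫ t, y n t * w n t ∂mu) + ∫ t, w n t * q t ∂mu) U
        (𝓝 (∫ t, h t ∂mu)) := by simpa using h1.add h2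
    refine ge_of_tendsto h3 ?_
    filter_upwards [hWδ] with n hn
    refine hn.trans (le_of_eq ?_)
    have e1 : x n (T (W n)) = ∫ t, y n t * w n t ∂mu := by
      refine (hy n (W n)).trans (integral_congr_ae ?_)
      filter_upwards [hWw n] with t ht
      rw [ht]
    have e2 : ξ (T (W n)) = ∫ t, w n t * q t ∂mu := by
      refine (hq (W n)).trans (integral_congr_ae ?_)
      filter_upwards [hWw n] with t ht
      rw [ht, mul_comm]
    rw [← e1, ← e2]
    simpa [x] using (hξ' n).symm
  have hE : MeasurableSet {t | δ / 2 ≤ h t} := measurableSet_le measurable_const hhm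
  refine ⟨U, w, y, x, {t | δ / 2 ≤ h t}, δ / 4, hwm, hw1, hw, hx2, fun v => ?_, hybm, hy, hE,
    ?_, by positivity, fun B hBE hB hBpos => ?_⟩
  · simpa [x] using (hξ v).sub_const (ξ v)
  · refine measureReal_nonneg.lt_of_ne fun h0 => ?_
    have h1 : ∀ᵐ t ∂mu, t ∉ {t | δ / 2 ≤ h t} :=
      measure_eq_zero_iff_ae_notMem.1 ((measureReal_eq_zero_iff).1 h0.symm)
    have h2 : ∫ t, h t ∂mu ≤ ∫ _, δ / 2 ∂mu := by
      refine integral_mono_ae hhbm.integrable (integrable_const _) ?_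
      filter_upwards [h1] with t ht
      exact (not_le.1 ht).le
    simp only [integral_const, probReal_univ, one_smul] at h2
    linarith
  · have h1 := hh (B.indicator fun _ => 1) ((integrable_const _).indicator hB)
    have e (f : ℝ → ℝ) : ∫ t, f t * B.indicator (fun _ => 1) t ∂mu = ∫ t in B, f t ∂mu := by
      rw [← integral_indicator hB]
      congr 1
      funext t
      by_cases ht : t ∈ B <;> simp [ht]
    simp only [e] at h1
    have h2 : δ / 2 * mu.real B ≤ ∫ t in B, h t ∂mu := by
      have := setIntegral_mono_on (integrable_const (δ / 2)).integrableOn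
        hhbm.integrable.integrableOn hB (μ := mu) fun t ht => hBE ht
      simpa [mul_comm] using this
    have h3 : δ / 4 * mu.real B < ∫ t in B, h t ∂mu := by nlinarith
    exact (h1.eventually_const_le h3)

end Correlated

section Correction

/-- A family in a vector space on which finitely many linear functionals tend to zero can be
corrected, by small multiples of fixed vectors, to be annihilated by these functionals. Here `Q` is
any notion of smallness of families. -/
theorem exists_small_correction {V ι J : Type*} [AddCommGroup V] [Module ℝ V] {l : Filter ι}
    (ℓ : J → V →ₗ[ℝ] ℝ) {a : ι → V} (Q : (ι → V) → Prop) (hQ0 : Q 0)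
    (hQadd : ∀ b b', Q b → Q b' → Q (b + b'))
    (hQsmul : ∀ (c : ι → ℝ) (p : V), Tendsto c l (𝓝 0) → Q fun n => c n • p)
    (s : Finset J) (ha : ∀ j ∈ s, Tendsto (fun n => ℓ j (a n)) l (𝓝 0)) :
    ∃ b, Q b ∧ ∀ j ∈ s, ∀ n, ℓ j (a n - b n) = 0 := by
  classical
  suffices h : ∃ b, Q b ∧ (∀ m : V →ₗ[ℝ] ℝ, Tendsto (fun n => m (b n)) l (𝓝 0)) ∧
      ∀ j ∈ s, ∀ n, ℓ j (a n - b n) = 0 by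
    obtain ⟨b, hb, -, h⟩ := h
    exact ⟨b, hb, h⟩
  induction s using Finset.induction_on with
  | empty => exact ⟨0, hQ0, fun m => by simpa using tendsto_const_nhds, by simp⟩
  | insert i s hi ih =>
    obtain ⟨b, hb, hbm, hbs⟩ := ih fun j hj => ha j (Finset.mem_insert_of_mem hj)
    by_cases hp : ∃ p : V, (∀ j ∈ s, ℓ j p = 0) ∧ ℓ i p ≠ 0
    · obtain ⟨p, hps, hpi⟩ := hp
      let c (n : ι) : ℝ := ℓ i (a n - b n) * (ℓ i p)⁻¹
      have hc : Tendsto c l (𝓝 0) := by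
        simpa [c] using ((ha i (Finset.mem_insert_self i s)).sub (hbm (ℓ i))).mul_const (ℓ i p)⁻¹
      refine ⟨b + fun n => c n • p, hQadd _ _ hb (hQsmul c p hc), fun m => ?_, fun j hj n => ?_⟩
      · simpa using (hbm m).add (hc.mul_const (m p))
      · rw [Pi.add_apply, ← sub_sub, map_sub, map_smul, smul_eq_mul]
        rcases Finset.mem_insert.1 hj with rfl | hj
        · simp [c, hpi]
        · rw [hbs j hj, hps j hj, mul_zero, sub_zero]
    · push Not at hp
      refine ⟨b, hb, hbm, fun j hj n => ?_⟩
      rcases Finset.mem_insert.1 hj with rfl | hj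
      · exact hp _ fun j hj => hbs j hj n
      · exact hbs j hj n

/-- Correction of functionals to be annihilated by finitely many vectors. -/
theorem exists_dual_correction {X ι : Type*} [NormedAddCommGroup X] [NormedSpace ℝ X]
    {l : Filter ι} {x : ι → X →L[ℝ] ℝ} (hx : ∀ v, Tendsto (fun n => x n v) l (𝓝 0))
    (s : Finset X) :
    ∃ r : ι → X →L[ℝ] ℝ, Tendsto r l (𝓝 0) ∧ ∀ v ∈ s, ∀ n, x n v = r n v := by
  obtain ⟨r, hr, hrs⟩ := exists_small_correction (l := l) (a := x)
    (fun v : X => (ContinuousLinearMap.apply ℝ ℝ v).toLinearMap) (fun r => Tendsto r l (𝓝 0))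
    tendsto_const_nhds (fun b b' h h' => add_zero (0 : X →L[ℝ] ℝ) ▸ h.add h')
    (fun c p h => by simpa using h.smul_const p) s fun v _ => hx v
  exact ⟨r, hr, fun v hv n => sub_eq_zero.1 (hrs v hv n)⟩

/-- Correction of bounded functions to be annihilated by finitely many bounded functions. -/
theorem exists_function_correction {ι α J : Type*} [Finite J] [MeasurableSpace α] {μ : Measure α}
    [IsFiniteMeasure μ] {l : Filter ι} {w : ι → α → ℝ} (hw : ∀ n, BddMeas (w n))
    {u : J → α → ℝ} (hu : ∀ j, BddMeas (u j))
    (hwu : ∀ j, Tendsto (fun n => ∫ t, w n t * u j t ∂μ) l (𝓝 0)) :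
    ∃ r : ι → α → ℝ, (∀ n, Measurable (r n)) ∧ (∀ ε > 0, ∀ᶠ n in l, ∀ t, |r n t| ≤ ε) ∧
      ∀ j n, ∫ t, (w n t - r n t) * u j t ∂μ = 0 := by
  have := Fintype.ofFinite J
  let V : Submodule ℝ (α → ℝ) :=
    { carrier := {f | BddMeas f}
      add_mem' := fun hf hg => hf.add hg
      zero_mem' := BddMeas.const 0
      smul_mem' := fun c f hf => hf.const_mul c }
  have hV (f : V) : BddMeas f.1 := f.2
  let ℓ (j : J) : V →ₗ[ℝ] ℝ :=
    { toFun := fun f => ∫ t, f.1 t * u j t ∂μ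
      map_add' := fun f g => by
        rw [← integral_add ((hV f).mul (hu j)).integrable ((hV g).mul (hu j)).integrable]
        simp [add_mul]
      map_smul' := fun c f => by
        simp [mul_assoc, integral_const_mul] }
  obtain ⟨r, hr, hrs⟩ := exists_small_correction (l := l) (a := fun n => (⟨w n, hw n⟩ : V)) ℓ
    (fun r => ∀ ε > 0, ∀ᶠ n in l, ∀ t, |(r n).1 t| ≤ ε) (fun ε hε => by simp [hε.le])
    (fun b b' h h' ε hε => by
      filter_upwards [h (ε / 2) (half_pos hε), h' (ε / 2) (half_pos hε)] with n h1 h2 t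
      refine (abs_add_le _ _).trans ?_
      linarith [h1 t, h2 t])
    (fun c p h ε hε => by
      obtain ⟨K, hK⟩ := (hV p).2
      have h1 : Tendsto (fun n => |c n| * |K|) l (𝓝 0) := by simpa using h.abs.mul_const |K|
      filter_upwards [h1.eventually_le_const hε] with n hn t
      refine le_trans (le_of_eq (abs_mul _ _)) (le_trans ?_ hn)
      exact mul_le_mul_of_nonneg_left ((hK t).trans (le_abs_self K)) (abs_nonneg _))
    Finset.univ fun j _ => hwu j
  exact ⟨fun n => (r n).1, fun n => (hV (r n)).measurable, hr,
    fun j n => hrs j (Finset.mem_univ j) n⟩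

end Correction

section Step

theorem integral_mul_indicator {α : Type*} [MeasurableSpace α] {μ : Measure α} {B : Set α}
    (hB : MeasurableSet B) (f g : α → ℝ) :
    ∫ t, f t * B.indicator g t ∂μ = ∫ t in B, f t * g t ∂μ := by
  rw [← integral_indicator hB]
  congr 1
  funext t
  by_cases ht : t ∈ B <;> simp [ht]

theorem norm_toL1_le {p : ℝ → ℝ} (hp : Integrable p mu) {K : ℝ} (hK : 0 ≤ K)
    (hpK : ∀ t, |p t| ≤ K) : ‖hp.toL1 p‖ ≤ K := by
  have := Lp.norm_le_of_ae_bound (p := 1) (f := hp.toL1 p) hK (by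
    filter_upwards [hp.coeFn_toL1] with t ht
    rw [ht]
    exact hpK t)
  simpa [measureUnivNNReal] using this

theorem abs_indicator_le {α : Type*} (B : Set α) {p : α → ℝ} {K : ℝ} (hpK : ∀ t, |p t| ≤ K)
    (t : α) : |B.indicator p t| ≤ K := by
  by_cases ht : t ∈ B
  · simpa [ht] using hpK t
  · simpa [ht] using (abs_nonneg _).trans (hpK t)

/-- The basic step: on finitely many cells of a fixed set `E`, one finds a functional `x` on `X`
annihilating given vectors, and a two-valued function orthogonal to given functions on each cell
which has a prescribed correlation with the density of `x ∘ T` on each cell. -/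
theorem exists_functional_signOn {X : Type*} [NormedAddCommGroup X] [NormedSpace ℝ X]
    {T : Lp ℝ 1 mu →L[ℝ] X} (hT : ¬ CompletelyContinuous T) :
    ∃ (E : Set ℝ) (c : ℝ), MeasurableSet E ∧ 0 < mu.real E ∧ 0 < c ∧
      ∀ (κ J : Type) [Finite κ] [Finite J] (B : κ → Set ℝ) (u : J → ℝ → ℝ) (F : Finset X),
        (∀ k, MeasurableSet (B k)) → (∀ k, B k ⊆ E) → (∀ k, 0 < mu.real (B k)) →
        Pairwise (Function.onFun Disjoint B) → (∀ j, BddMeas (u j)) →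
        ∃ (x : X →L[ℝ] ℝ) (y : ℝ → ℝ) (S : Set ℝ), ‖x‖ ≤ 3 ∧ (∀ v ∈ F, x v = 0) ∧ BddMeas y ∧
          (∀ f : Lp ℝ 1 mu, x (T f) = ∫ t, y t * f t ∂mu) ∧ MeasurableSet S ∧
          ∀ k, ∫ t in B k, y t ∂mu = 0 ∧
            ∫ t in B k, signOn S t * y t ∂mu = c * mu.real (B k) ∧
            ∀ j, ∫ t in B k, signOn S t * u j t ∂mu = 0 := by
  classical
  obtain ⟨U, w, y, x, E, c, hwm, hw1, hw, hx2, hx, hyb, hy, hE, hEpos, hc, hcorr⟩ :=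
    exists_correlated_families hT
  refine ⟨E, c / 4, hE, hEpos, by positivity, ?_⟩
  intro κ J _ _ B u F hB hBE hBpos hBd hu
  have := Fintype.ofFinite κ
  have hwb n : BddMeas (w n) := ⟨hwm n, 1, hw1 n⟩
  have hone k : BddMeas ((B k).indicator fun _ => (1 : ℝ)) := (BddMeas.const 1).indicator (hB k)
  obtain ⟨r, hr, hrF⟩ := exists_dual_correction hx
    (F ∪ Finset.univ.image fun k => T ((hone k).integrable.toL1 _))
  obtain ⟨s, hsm, hs, hsu⟩ := exists_function_correction (μ := mu) (l := (U : Filter ℕ)) hwb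
    (u := fun kj : κ × J => (B kj.1).indicator (u kj.2)) (fun kj => (hu kj.2).indicator (hB kj.1))
    fun kj => hw _ ((hu kj.2).indicator (hB kj.1)).integrable
  have hr1 : ∀ᶠ n in U, ‖r n‖ ≤ 1 := (by simpa using hr.norm : Tendsto (fun n => ‖r n‖) U
    (𝓝 0)).eventually_le_const one_pos
  have hrk : ∀ᶠ n in U, ∀ k, ‖r n‖ * ‖T‖ ≤ c / 4 * mu.real (B k) := by
    refine eventually_all.2 fun k => ?_
    have h1 : Tendsto (fun n => ‖r n‖ * ‖T‖) U (𝓝 0) := by simpa using hr.norm.mul_const ‖T‖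
    exact h1.eventually_le_const (mul_pos (by positivity) (hBpos k))
  have hsk : ∀ᶠ n in U, ∀ k t, |s n t| ≤ c / 4 * mu.real (B k) / (3 * ‖T‖ + 1) :=
    eventually_all.2 fun k => hs _ (div_pos (mul_pos (by positivity) (hBpos k)) (by positivity))
  have hck : ∀ᶠ n in U, ∀ k, c * mu.real (B k) ≤ ∫ t in B k, y n t * w n t ∂mu :=
    eventually_all.2 fun k => hcorr (B k) (hBE k) (hB k) (hBpos k)
  obtain ⟨n, hr1, hrk, hs1, hsk, hck⟩ :=
    (hr1.and (hrk.and ((hs 1 one_pos).and (hsk.and hck)))).exists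
  let x' : X →L[ℝ] ℝ := x n - r n
  have hx_norm : ‖x'‖ ≤ 3 := (norm_sub_le _ _).trans (by linarith [hx2 n])
  obtain ⟨y', hy_meas, hy_bound, hy'⟩ := exists_density (x'.comp T)
  have hy_bdd : BddMeas y' := ⟨hy_meas, _, hy_bound⟩
  have hx_ann v (hv : v ∈ F ∪ Finset.univ.image fun k => T ((hone k).integrable.toL1 _)) :
      x' v = 0 := sub_eq_zero.2 (hrF v hv n)
  let g (t : ℝ) : ℝ := w n t - s n t
  have hgm : Measurable g := (hwm n).sub (hsm n)
  have hg2 t : |g t| ≤ 2 := (abs_sub _ _).trans (by linarith [hw1 n t, hs1 t])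
  have hgb : BddMeas g := ⟨hgm, 2, hg2⟩
  have hsb : BddMeas (s n) := ⟨hsm n, 1, hs1⟩
  have hval k : c / 2 * mu.real (B k) ≤ ∫ t in B k, g t * y' t ∂mu := by
    have iw := ((hwb n).indicator (hB k)).integrable (μ := mu)
    have is := (hsb.indicator (hB k)).integrable (μ := mu)
    have e1 : ∫ t in B k, g t * y' t ∂mu = x' (T (iw.toL1 _)) - x' (T (is.toL1 _)) := by
      have h1 := hy' (iw.toL1 _)
      have h2 := hy' (is.toL1 _)
      rw [integral_mul_toL1, integral_mul_indicator (hB k), ContinuousLinearMap.comp_apply] at h1 h2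
      rw [h1, h2, ← integral_sub (hy_bdd.mul (hwb n)).integrable (hy_bdd.mul hsb).integrable]
      congr 1
      funext t
      simp only [g]
      ring
    have e2 : x' (T (iw.toL1 _))
        = (∫ t in B k, y n t * w n t ∂mu) - r n (T (iw.toL1 _)) := by
      rw [← integral_mul_indicator (hB k), ← integral_mul_toL1 iw, ← hy]
      rfl
    have b1 : |r n (T (iw.toL1 _))| ≤ c / 4 * mu.real (B k) := by
      have h1 := (r n).le_opNorm_of_le (T.le_opNorm_of_le
        (norm_toL1_le iw zero_le_one (abs_indicator_le _ (hw1 n))))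
      rw [mul_one] at h1
      exact h1.trans (hrk k)
    have b2 : |x' (T (is.toL1 _))| ≤ c / 4 * mu.real (B k) := by
      have h0 : 0 ≤ c / 4 * mu.real (B k) := mul_nonneg (by positivity) (hBpos k).le
      have h1 := x'.le_opNorm_of_le (T.le_opNorm_of_le
        (norm_toL1_le is (by positivity) (abs_indicator_le _ (hsk k))))
      refine h1.trans ?_
      rw [← mul_assoc, mul_div_assoc', div_le_iff₀ (by positivity), mul_comm]
      refine mul_le_mul_of_nonneg_left ?_ h0
      nlinarith [mul_le_mul_of_nonneg_right hx_norm (norm_nonneg T)]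
    rw [e1, e2]
    linarith [hck k, (abs_le.1 b1).2, (abs_le.1 b2).2]
  let θ (k : κ) : ℝ := c / 4 * mu.real (B k) / ∫ t in B k, g t * y' t ∂mu
  have hvalpos k : 0 < ∫ t in B k, g t * y' t ∂mu :=
    (mul_pos (by positivity) (hBpos k)).trans_le (hval k)
  have hθ0 k : 0 ≤ θ k := div_nonneg (mul_nonneg (by positivity) (hBpos k).le) (hvalpos k).le
  have hθ k : θ k ≤ 1 / 2 := by
    rw [div_le_iff₀ (hvalpos k)]
    linarith [hval k]
  let G (t : ℝ) : ℝ := ∑ k, (B k).indicator (fun t => θ k * g t) t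
  have hGk k t (ht : t ∈ B k) : G t = θ k * g t := by
    rw [show G t = _ from Finset.sum_eq_single k (fun j _ hj => Set.indicator_of_notMem
      (Set.disjoint_left.1 (hBd hj.symm) ht) _) (by simp), Set.indicator_of_mem ht]
  have hGm : Measurable G :=
    Finset.measurable_fun_sum _ fun k _ => (hgm.const_mul (θ k)).indicator (hB k)
  have hG1 t : |G t| ≤ 1 := by
    by_cases h : ∃ k, t ∈ B k
    · obtain ⟨k, hk⟩ := h
      rw [hGk k t hk, abs_mul, abs_of_nonneg (hθ0 k)]
      nlinarith [hθ k, hg2 t, abs_nonneg (g t), hθ0 k]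
    · push Not at h
      simp [G, h]
  obtain ⟨S, hS, hSG⟩ := exists_signOn_integral_eq
    (u := Sum.elim (fun k => (B k).indicator y')
      fun kj : κ × J => (B kj.1).indicator (u kj.2))
    (by
      rintro (k | kj)
      · exact hy_bdd.indicator (hB k)
      · exact (hu kj.2).indicator (hB kj.1)) hGm hG1
  have hGint k (p : ℝ → ℝ) : ∫ t in B k, G t * p t ∂mu = θ k * ∫ t in B k, g t * p t ∂mu := by
    rw [← integral_const_mul]
    refine setIntegral_congr_fun (hB k) fun t ht => ?_
    simp only [hGk k t ht, mul_assoc]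
  refine ⟨x', y', S, hx_norm, fun v hv => hx_ann v (Finset.mem_union_left _ hv), hy_bdd, hy', hS,
    fun k => ⟨?_, ?_, fun j => ?_⟩⟩
  · have h1 := hx_ann _ (Finset.mem_union_right F
      (Finset.mem_image_of_mem (fun k => T ((hone k).integrable.toL1 _)) (Finset.mem_univ k)))
    have h2 := hy' ((hone k).integrable.toL1 _)
    rw [integral_mul_toL1, integral_mul_indicator (hB k), ContinuousLinearMap.comp_apply, h1] at h2
    simpa using h2.symm
  · have h1 := hSG (Sum.inl k)
    simp only [Sum.elim_inl] at h1
    rw [integral_mul_indicator (hB k), integral_mul_indicator (hB k), hGint] at h1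
    rw [h1, div_mul_cancel₀ _ (hvalpos k).ne']
  · have h1 := hSG (Sum.inr (k, j))
    simp only [Sum.elim_inr] at h1
    rw [integral_mul_indicator (hB k), integral_mul_indicator (hB k), hGint] at h1
    have h2 := hsu (k, j) n
    simp only at h2
    rw [integral_mul_indicator (hB k)] at h2
    rw [h1, show (∫ t in B k, g t * u j t ∂mu) = 0 from h2, mul_zero]

end Step

section Halving

theorem setIntegral_inter_signOn {f : ℝ → ℝ} (hf : BddMeas f) {B S : Set ℝ}
    (hS : MeasurableSet S) :
    ∫ t in B ∩ S, f t ∂mu = (∫ t in B, f t ∂mu + ∫ t in B, signOn S t * f t ∂mu) / 2 ∧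
    ∫ t in B ∩ Sᶜ, f t ∂mu = (∫ t in B, f t ∂mu - ∫ t in B, signOn S t * f t ∂mu) / 2 := by
  have h1 : ∫ t in B, f t ∂mu = ∫ t in B ∩ S, f t ∂mu + ∫ t in B ∩ Sᶜ, f t ∂mu := by
    have := integral_add_compl hS (μ := mu.restrict B) hf.integrable
    rw [Measure.restrict_restrict hS, Measure.restrict_restrict hS.compl, Set.inter_comm,
      Set.inter_comm _ B] at this
    exact this.symm
  have h2 : ∫ t in B, signOn S t * f t ∂mu
      = ∫ t in B ∩ S, f t ∂mu - ∫ t in B ∩ Sᶜ, f t ∂mu := by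
    have := integral_add_compl hS (μ := mu.restrict B) ((BddMeas.signOn hS).mul hf).integrable
    rw [setIntegral_congr_fun hS (g := f) fun t ht => by simp only [signOn_of_mem ht, one_mul],
      setIntegral_congr_fun hS.compl (g := fun t => - f t) fun t ht => by
        simp only [signOn_of_notMem ht, neg_one_mul], integral_neg,
      Measure.restrict_restrict hS, Measure.restrict_restrict hS.compl, Set.inter_comm,
      Set.inter_comm _ B] at this
    rw [← this, sub_eq_add_neg]
  exact ⟨by linarith, by linarith⟩

/-- All cells of a finite partition can be halved simultaneously, halving the integrals of given
functions, in such a way that the sign of the half agrees on average, up to a constant, with the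
density of a functional `x ∘ T`, where `x` annihilates given vectors. -/
theorem exists_halving {X : Type*} [NormedAddCommGroup X] [NormedSpace ℝ X]
    {T : Lp ℝ 1 mu →L[ℝ] X} (hT : ¬ CompletelyContinuous T) :
    ∃ (E : Set ℝ) (c : ℝ), MeasurableSet E ∧ 0 < mu.real E ∧ 0 < c ∧
      ∀ (κ J : Type) [Finite κ] [Finite J] (B : κ → Set ℝ) (u : J → ℝ → ℝ) (F : Finset X),
        (∀ k, MeasurableSet (B k)) → (∀ k, B k ⊆ E) → (∀ k, 0 < mu.real (B k)) →
        Pairwise (Function.onFun Disjoint B) → (∀ j, BddMeas (u j)) →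
        ∃ (x : X →L[ℝ] ℝ) (y : ℝ → ℝ) (S : Set ℝ), ‖x‖ ≤ 3 ∧ (∀ v ∈ F, x v = 0) ∧ BddMeas y ∧
          (∀ f : Lp ℝ 1 mu, x (T f) = ∫ t, y t * f t ∂mu) ∧ MeasurableSet S ∧
          ∀ k, ∀ H ∈ ({S, Sᶜ} : Set (Set ℝ)), mu.real (B k ∩ H) = mu.real (B k) / 2 ∧
            ∫ t in B k ∩ H, (y t - c * signOn S t) ∂mu = 0 ∧
            ∀ j, ∫ t in B k ∩ H, u j t ∂mu = (∫ t in B k, u j t ∂mu) / 2 := by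
  obtain ⟨E, c, hE, hEpos, hc, hstep⟩ := exists_functional_signOn hT
  refine ⟨E, c, hE, hEpos, hc, ?_⟩
  intro κ J _ _ B u F hB hBE hBpos hBd hu
  obtain ⟨x, y, S, hx, hxF, hy, hxy, hS, h⟩ := hstep κ (Option J) B
    (fun j => j.elim (fun _ => 1) u) F hB hBE hBpos hBd
    (fun j => j.casesOn (BddMeas.const 1) hu)
  refine ⟨x, y, S, hx, hxF, hy, hxy, hS, fun k => ?_⟩
  obtain ⟨hk0, hkc, hku⟩ := h k
  have hs : ∫ t in B k, signOn S t ∂mu = 0 := by simpa using hku none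
  have hss t : signOn S t * signOn S t = 1 := by
    rw [← abs_mul_abs_self, abs_signOn, one_mul]
  have hyi := hy.integrable (μ := mu.restrict (B k))
  have hcs := (BddMeas.signOn hS).const_mul c
  have e1 : ∫ t in B k, (y t - c * signOn S t) ∂mu = 0 := by
    rw [integral_sub hyi hcs.integrable, integral_const_mul, hk0, hs]
    simp
  have e2 : ∫ t in B k, signOn S t * (y t - c * signOn S t) ∂mu = 0 := by
    have : ∀ t, signOn S t * (y t - c * signOn S t) = signOn S t * y t - c := fun t => by
      rw [mul_sub, mul_left_comm, hss, mul_one]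
    simp only [this]
    rw [integral_sub ((BddMeas.signOn hS).mul hy).integrable (integrable_const c), hkc]
    simp [mul_comm]
  have g1 := setIntegral_inter_signOn (BddMeas.const (α := ℝ) 1) (B := B k) hS
  simp only [mul_one, hs, integral_const, smul_eq_mul, measureReal_restrict_apply_univ, add_zero,
    sub_zero] at g1
  have g2 := setIntegral_inter_signOn (hy.sub hcs) (B := B k) hS
  simp only [e1, e2, add_zero, sub_zero, zero_div] at g2
  have g3 j := setIntegral_inter_signOn (hu j) (B := B k) hS
  have hkj j : ∫ t in B k, signOn S t * u j t ∂mu = 0 := hku (some j)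
  simp only [hkj, add_zero, sub_zero] at g3
  rintro H (rfl | rfl)
  · exact ⟨g1.1, g2.1, fun j => (g3 j).1⟩
  · exact ⟨g1.2, g2.2, fun j => (g3 j).2⟩

end Halving

section Dyadic

variable {X : Type*} [NormedAddCommGroup X] [NormedSpace ℝ X]

/-- A stage of the dyadic construction: a partition of `E` into `2 ^ n` cells of equal measure,
numbered by `idx`, a finite set of functions with integral zero on every cell, and a functional on
`X` whose composition with `T` has density `y`, correlated with the parity of `idx`. -/
structure DyadicStage (T : Lp ℝ 1 mu →L[ℝ] X) (E : Set ℝ) (c : ℝ) (d : ℕ → X) (n : ℕ) where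
  idx : ℝ → ℕ
  fns : Finset (ℝ → ℝ)
  x : X →L[ℝ] ℝ
  y : ℝ → ℝ
  measurable_idx : Measurable idx
  idx_lt : ∀ t, idx t < 2 ^ n
  bddMeas_fns : ∀ v ∈ fns, BddMeas v
  measure_cell : ∀ k < 2 ^ n, mu.real (E ∩ idx ⁻¹' {k}) = mu.real E / 2 ^ n
  integral_fns : ∀ k < 2 ^ n, ∀ v ∈ fns, ∫ t in E ∩ idx ⁻¹' {k}, v t ∂mu = 0
  sub_mem_fns : (fun t => y t - c * (-1) ^ idx t) ∈ fns
  norm_x_le : ‖x‖ ≤ 3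
  x_eq_zero : ∀ i < n, x (d i) = 0
  bddMeas_y : BddMeas y
  x_apply : ∀ f : Lp ℝ 1 mu, x (T f) = ∫ t, y t * f t ∂mu

/-- An infinite sequence of compatible dyadic stages. -/
theorem exists_dyadicStages {T : Lp ℝ 1 mu →L[ℝ] X} (hT : ¬ CompletelyContinuous T) (d : ℕ → X) :
    ∃ (E : Set ℝ) (c : ℝ), MeasurableSet E ∧ 0 < mu.real E ∧ 0 < c ∧
      ∃ s : ∀ n, DyadicStage T E c d n, ∀ n, (s n).fns ⊆ (s (n + 1)).fns ∧
        ∀ t, (s (n + 1)).idx t / 2 = (s n).idx t := by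
  classical
  obtain ⟨E', c, hE', hEpos', hc, hhalf⟩ := exists_halving hT
  obtain ⟨x₀, y₀, S₀, hx₀, -, hy₀, hxy₀, hS₀, h₀⟩ := hhalf Unit Empty (fun _ => E') Empty.elim ∅
    (fun _ => hE') (fun _ => subset_rfl) (fun _ => hEpos') (fun i j h => (h rfl).elim)
    (fun j => j.elim)
  obtain ⟨hm₀, hi₀, -⟩ := h₀ () S₀ (by simp)
  have hE : MeasurableSet (E' ∩ S₀) := hE'.inter hS₀
  have hEpos : 0 < mu.real (E' ∩ S₀) := hm₀ ▸ half_pos hEpos'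
  generalize hEdef : E' ∩ S₀ = E at *
  let s₀ : DyadicStage T E c d 0 :=
    { idx := fun _ => 0
      fns := {fun t => y₀ t - c * (-1) ^ 0}
      x := x₀
      y := y₀
      measurable_idx := measurable_const
      idx_lt := by simp
      bddMeas_fns := by
        intro v hv
        rw [Finset.mem_singleton.1 hv]
        exact hy₀.sub (BddMeas.const _)
      measure_cell := by simp
      integral_fns := by
        intro k hk v hv
        have hk0 : k = 0 := by simpa using hk
        rw [Finset.mem_singleton.1 hv, ← hi₀]
        have : E ∩ (fun _ : ℝ => 0) ⁻¹' {k} = E := by simp [hk0]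
        rw [this]
        refine setIntegral_congr_fun hE fun t ht => ?_
        have : t ∈ S₀ := (hEdef ▸ ht : t ∈ E' ∩ S₀).2
        simp [signOn_of_mem this]
      sub_mem_fns := Finset.mem_singleton_self _
      norm_x_le := hx₀
      x_eq_zero := by simp
      bddMeas_y := hy₀
      x_apply := hxy₀ }
  have hnext n (s : DyadicStage T E c d n) : ∃ s' : DyadicStage T E c d (n + 1),
      s.fns ⊆ s'.fns ∧ ∀ t, s'.idx t / 2 = s.idx t := by
    have hcell k : MeasurableSet (E ∩ s.idx ⁻¹' {k}) :=
      hE.inter (s.measurable_idx (measurableSet_singleton k))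
    obtain ⟨x, y, S, hx, hxF, hy, hxy, hS, h⟩ := hhalf (Fin (2 ^ n)) s.fns
      (fun k => E ∩ s.idx ⁻¹' {(k : ℕ)}) (fun v => v.1) ((Finset.range (n + 1)).image d)
      (fun k => hcell k) (fun k => Set.inter_subset_left.trans (hEdef ▸ Set.inter_subset_left))
      (fun k => by
        rw [s.measure_cell k k.2]
        positivity)
      (fun i j hij => Set.disjoint_left.2 fun t hi hj => hij (Fin.ext (hi.2.symm.trans hj.2)))
      (fun v => s.bddMeas_fns v.1 v.2)
    let idx (t : ℝ) : ℕ := 2 * s.idx t + if t ∈ S then 0 else 1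
    have hidx t : idx t / 2 = s.idx t := by
      simp only [idx]
      split_ifs <;> omega
    have hsign : (fun t => y t - c * (-1) ^ idx t) = fun t => y t - c * signOn S t := by
      funext t
      by_cases ht : t ∈ S
      · simp [idx, ht, signOn_of_mem]
      · simp [idx, ht, signOn_of_notMem, pow_succ]
    have hcells k (hk : k < 2 ^ (n + 1)) : ∃ q : Fin (2 ^ n), ∃ H ∈ ({S, Sᶜ} : Set (Set ℝ)),
        E ∩ idx ⁻¹' {k} = E ∩ s.idx ⁻¹' {(q : ℕ)} ∩ H := by
      have hq : k / 2 < 2 ^ n := by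
        rw [pow_succ] at hk
        omega
      refine ⟨⟨k / 2, hq⟩, ?_⟩
      rcases Nat.even_or_odd' k with ⟨m, rfl | rfl⟩
      · refine ⟨S, by simp, ?_⟩
        ext t
        by_cases ht : t ∈ S <;> simp [idx, ht]
        · omega
      · refine ⟨Sᶜ, by simp, ?_⟩
        ext t
        by_cases ht : t ∈ S <;> simp [idx, ht] <;> omega
    refine ⟨{
      idx := idx
      fns := insert (fun t => y t - c * signOn S t) s.fns
      x := x
      y := y
      measurable_idx := (s.measurable_idx.const_mul 2).add
        (Measurable.ite hS measurable_const measurable_const)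
      idx_lt := fun t => by
        have := s.idx_lt t
        rw [← hidx, Nat.div_lt_iff_lt_mul two_pos] at this
        rwa [pow_succ]
      bddMeas_fns := fun v hv => by
        rcases Finset.mem_insert.1 hv with rfl | hv
        · exact hy.sub ((BddMeas.signOn hS).const_mul c)
        · exact s.bddMeas_fns v hv
      measure_cell := fun k hk => by
        obtain ⟨q, H, hH, e⟩ := hcells k hk
        rw [e, (h q H hH).1, s.measure_cell q q.2, pow_succ, div_div]
      integral_fns := fun k hk v hv => by
        obtain ⟨q, H, hH, e⟩ := hcells k hk
        rw [e]
        rcases Finset.mem_insert.1 hv with rfl | hv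
        · exact (h q H hH).2.1
        · have h1 := (h q H hH).2.2 ⟨v, hv⟩
          simp only at h1
          rw [h1, s.integral_fns q q.2 v hv, zero_div]
      sub_mem_fns := by
        rw [hsign]
        exact Finset.mem_insert_self _ _
      norm_x_le := hx
      x_eq_zero := fun i hi =>
        hxF _ (Finset.mem_image_of_mem d (Finset.mem_range.2 hi))
      bddMeas_y := hy
      x_apply := hxy }, Finset.subset_insert _ _, hidx⟩
  choose next hnext using hnext
  exact ⟨E, c, hE, hEpos, hc, fun n => Nat.rec s₀ next n, fun n => hnext n _⟩

end Dyadic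

section Distribution

/-- Riemann sums converge to the integral of `v * (f ∘ θ)` when `θ` is approximated by dyadic
step functions on whose level sets `v` has equal integrals. -/
theorem tendsto_dyadic_sum {α : Type*} [MeasurableSpace α] {ν : Measure α} [IsFiniteMeasure ν]
    {idx : ℕ → α → ℕ} {θ : α → ℝ} (hidx : ∀ n, Measurable (idx n))
    (hlt : ∀ n, ∀ᵐ t ∂ν, idx n t < 2 ^ n)
    (hθ : ∀ᵐ t ∂ν, Tendsto (fun n => (idx n t : ℝ) / 2 ^ n) atTop (𝓝 (θ t)))
    {v : α → ℝ} (hv : BddMeas v) {b : ℝ}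
    (hb : ∀ᶠ n in atTop, ∀ k < 2 ^ n, ∫ t in idx n ⁻¹' {k}, v t ∂ν = b / 2 ^ n)
    (f : BoundedContinuousFunction ℝ ℝ) :
    Tendsto (fun n : ℕ => ∑ k ∈ Finset.range (2 ^ n), f ((k : ℝ) / 2 ^ n) * (b / 2 ^ n)) atTop
      (𝓝 (∫ t, v t * f (θ t) ∂ν)) := by
  obtain ⟨K, hK⟩ := id hv.2
  have hqm n : Measurable fun t => (idx n t : ℝ) / 2 ^ n :=
    (measurable_from_nat.comp (hidx n)).div_const _
  have hDCT : Tendsto (fun n => ∫ t, v t * f ((idx n t : ℝ) / 2 ^ n) ∂ν) atTop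
      (𝓝 (∫ t, v t * f (θ t) ∂ν)) := by
    refine tendsto_integral_of_dominated_convergence (fun _ => K * ‖f‖)
      (fun n => (hv.measurable.mul (f.continuous.measurable.comp (hqm n))).aestronglyMeasurable)
      (integrable_const _) (fun n => ae_of_all _ fun t => ?_) ?_
    · rw [norm_mul]
      exact mul_le_mul (hK t) (f.norm_coe_le_norm _) (norm_nonneg _) ((abs_nonneg _).trans (hK t))
    · filter_upwards [hθ] with t ht
      exact ((f.continuous.tendsto _).comp ht).const_mul _
  refine hDCT.congr' ?_
  filter_upwards [hb] with n hn
  have hcell k : MeasurableSet (idx n ⁻¹' {k}) := hidx n (measurableSet_singleton k)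
  calc ∫ t, v t * f ((idx n t : ℝ) / 2 ^ n) ∂ν
      = ∫ t, ∑ k ∈ Finset.range (2 ^ n),
          (idx n ⁻¹' {k}).indicator (fun t => f ((k : ℝ) / 2 ^ n) * v t) t ∂ν := by
        refine integral_congr_ae ?_
        filter_upwards [hlt n] with t ht
        rw [Finset.sum_eq_single (idx n t)]
        · simp [mul_comm]
        · intro k _ hk
          exact Set.indicator_of_notMem (fun h => hk h.symm) _
        · intro h
          exact absurd (Finset.mem_range.2 ht) h
    _ = _ := by
        rw [integral_finsetSum _ fun k _ => ((hv.const_mul _).indicator (hcell k)).integrable]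
        refine Finset.sum_congr rfl fun k hk => ?_
        rw [integral_indicator (hcell k), integral_const_mul, hn k (Finset.mem_range.1 hk)]

/-- Dyadic Riemann sums converge to the integral with respect to Lebesgue measure. -/
theorem tendsto_dyadic_sum_mu (f : BoundedContinuousFunction ℝ ℝ) (b : ℝ) :
    Tendsto (fun n : ℕ => ∑ k ∈ Finset.range (2 ^ n), f ((k : ℝ) / 2 ^ n) * (b / 2 ^ n)) atTop
      (𝓝 (b * ∫ t, f t ∂mu)) := by
  have hI : ∀ᵐ t ∂mu, t ∈ Set.Icc (0 : ℝ) 1 := ae_restrict_mem measurableSet_Icc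
  have hne : ∀ᵐ t ∂mu, t ≠ (1 : ℝ) := by
    rw [ae_iff]
    simp
  have h := tendsto_dyadic_sum (ν := mu) (idx := fun n t => ⌊t * 2 ^ n⌋₊) (θ := id)
    (v := fun _ => b) (b := b) (fun n => Nat.measurable_floor.comp (measurable_id.mul_const _))
    (fun n => ?_) ?_
    (BddMeas.const b) (Eventually.of_forall fun n k hk => ?_) f
  · simpa [integral_const_mul] using h
  · filter_upwards [hI, hne] with t ht ht1
    have h1 : t < 1 := lt_of_le_of_ne ht.2 ht1
    rw [Nat.floor_lt (mul_nonneg ht.1 (by positivity))]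
    push_cast
    exact mul_lt_of_lt_one_left (by positivity) h1
  · filter_upwards [hI] with t ht
    exact (tendsto_nat_floor_mul_div_atTop ht.1).comp
      (tendsto_pow_atTop_atTop_of_one_lt (one_lt_two : (1 : ℝ) < 2))
  · have h2 : (0 : ℝ) < 2 ^ n := by positivity
    have hk' : (k : ℝ) + 1 ≤ 2 ^ n := by exact_mod_cast hk
    have hset : (fun t : ℝ => ⌊t * 2 ^ n⌋₊) ⁻¹' {k} ∩ Set.Icc 0 1
        = Set.Ico ((k : ℝ) / 2 ^ n) ((k + 1) / 2 ^ n) := by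
      ext t
      simp only [Set.mem_inter_iff, Set.mem_preimage, Set.mem_singleton_iff, Set.mem_Icc,
        Set.mem_Ico, div_le_iff₀ h2, lt_div_iff₀ h2]
      constructor
      · rintro ⟨h3, h4, -⟩
        exact (Nat.floor_eq_iff (mul_nonneg h4 h2.le)).1 h3
      · rintro ⟨h3, h4⟩
        have h5 : 0 ≤ t := nonneg_of_mul_nonneg_left (k.cast_nonneg.trans h3) h2
        exact ⟨(Nat.floor_eq_iff (mul_nonneg h5 h2.le)).2 ⟨h3, h4⟩, h5, by nlinarith⟩
    have hmu : mu.real ((fun t : ℝ => ⌊t * 2 ^ n⌋₊) ⁻¹' {k}) = 1 / 2 ^ n := by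
      rw [mu, measureReal_restrict_apply' measurableSet_Icc, hset, Real.volume_real_Ico_of_le
        (by gcongr; linarith)]
      ring
    rw [setIntegral_const, hmu, smul_eq_mul]
    ring

end Distribution

section DyadicLimit

/-- A refining sequence of dyadic indices converges to a point. -/
theorem exists_dyadic_limit {idx : ℕ → ℕ} (h : ∀ n, idx (n + 1) / 2 = idx n) :
    ∃ τ : ℝ, Tendsto (fun n => (idx n : ℝ) / 2 ^ n) atTop (𝓝 τ) ∧
      ∀ n, idx n ≤ 2 ^ n * τ ∧ 2 ^ n * τ ≤ idx n + 1 := by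
  have hmono : Monotone fun n => (idx n : ℝ) / 2 ^ n := monotone_nat_of_le_succ fun n => by
    have h1 : 2 * idx n ≤ idx (n + 1) := by have := h n; omega
    have h2 : (2 : ℝ) * idx n ≤ idx (n + 1) := by exact_mod_cast h1
    rw [div_le_div_iff₀ (by positivity) (by positivity), pow_succ]
    nlinarith [pow_pos (two_pos : (0 : ℝ) < 2) n]
  have hanti : Antitone fun n => ((idx n : ℝ) + 1) / 2 ^ n := antitone_nat_of_succ_le fun n => by
    have h1 : idx (n + 1) + 1 ≤ 2 * (idx n + 1) := by have := h n; omega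
    have h2 : (idx (n + 1) : ℝ) + 1 ≤ 2 * (idx n + 1) := by exact_mod_cast h1
    rw [div_le_div_iff₀ (by positivity) (by positivity), pow_succ]
    nlinarith [pow_pos (two_pos : (0 : ℝ) < 2) n]
  have hle m n : (idx m : ℝ) / 2 ^ m ≤ ((idx n : ℝ) + 1) / 2 ^ n :=
    calc (idx m : ℝ) / 2 ^ m ≤ (idx (max m n) : ℝ) / 2 ^ max m n := hmono (le_max_left m n)
      _ ≤ ((idx (max m n) : ℝ) + 1) / 2 ^ max m n := by gcongr; linarith
      _ ≤ _ := hanti (le_max_right m n)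
  have hlim := tendsto_atTop_ciSup hmono ⟨_, Set.forall_mem_range.2 fun m => hle m 0⟩
  refine ⟨_, hlim, fun n => ⟨?_, ?_⟩⟩
  · rw [← div_le_iff₀' (by positivity)]
    exact hmono.ge_of_tendsto hlim n
  · rw [← le_div_iff₀' (by positivity)]
    exact le_of_tendsto' hlim fun m => hle m n

theorem rademacher_eq_of_le {n k : ℕ} {s : ℝ} (h1 : k ≤ 2 ^ n * s) (h2 : 2 ^ n * s ≤ k + 1)
    (h3 : 2 ^ n * s ≠ k + 1) : rademacher n s = (-1) ^ k := by
  have : ⌊(2 : ℝ) ^ n * s⌋ = (k : ℤ) := by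
    rw [Int.floor_eq_iff]
    exact ⟨by exact_mod_cast h1, by exact_mod_cast h2.lt_of_ne h3⟩
  rw [rademacher, this, zpow_natCast]

theorem ae_forall_two_pow_mul_ne : ∀ᵐ s ∂mu, ∀ n k : ℕ, (2 : ℝ) ^ n * s ≠ k + 1 := by
  refine ae_all_iff.2 fun n => ae_all_iff.2 fun k => ?_
  have h : (mu : Measure ℝ) {((k : ℝ) + 1) / 2 ^ n} = 0 := measure_singleton _
  filter_upwards [measure_eq_zero_iff_ae_notMem.1 h] with s hs hs'
  refine hs (Set.mem_singleton_iff.2 ?_)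
  rw [← hs', mul_div_cancel_left₀ _ (by positivity)]

end DyadicLimit

section Embedding

/-- A map of a set `E` to `[0, 1]` that transports the restriction of Lebesgue measure to a
multiple of Lebesgue measure induces an isometric embedding of `L¹`. -/
theorem exists_isometry_of_map_eq {E : Set ℝ} (hE : MeasurableSet E) (hpos : 0 < mu.real E)
    {τ : ℝ → ℝ} (hτ : Measurable τ) (hmap : (mu.restrict E).map τ = mu E • mu) :
    ∃ A : Lp ℝ 1 mu →ₗᵢ[ℝ] Lp ℝ 1 mu, ∀ f : Lp ℝ 1 mu,
      A f =ᵐ[mu] E.indicator fun t => (mu.real E)⁻¹ * f (τ t) := by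
  have hq : Measure.QuasiMeasurePreserving τ (mu.restrict E) mu :=
    ⟨hτ, by rw [hmap]; exact Measure.smul_absolutelyContinuous⟩
  have hint (f : Lp ℝ 1 mu) : Integrable (fun t => f (τ t)) (mu.restrict E) := by
    refine Integrable.comp_measurable (g := f) ?_ hτ
    rw [hmap]
    exact (L1.integrable_coeFn f).smul_measure (measure_ne_top _ _)
  have hind (f : Lp ℝ 1 mu) : Integrable (E.indicator fun t => (mu.real E)⁻¹ * f (τ t)) mu :=
    (integrable_indicator_iff hE).2 ((hint f).const_mul _)
  have hcongr {p q : ℝ → ℝ} (h : p =ᵐ[mu] q) : ∀ᵐ t ∂mu, t ∈ E → p (τ t) = q (τ t) :=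
    (ae_restrict_iff' hE).1 (hq.ae_eq_comp h)
  refine ⟨
    { toFun := fun f => (hind f).toL1 _
      map_add' := fun f g => ?_
      map_smul' := fun r f => ?_
      norm_map' := fun f => ?_ }, fun f => (hind f).coeFn_toL1⟩
  · rw [← Integrable.toL1_add, Integrable.toL1_eq_toL1_iff]
    filter_upwards [hcongr (Lp.coeFn_add f g)] with t ht
    by_cases h : t ∈ E
    · have h1 := ht h
      rw [Pi.add_apply] at h1
      simp only [Set.indicator_of_mem h, Pi.add_apply, h1, mul_add]
    · simp [h]
  · rw [RingHom.id_apply, ← Integrable.toL1_smul', Integrable.toL1_eq_toL1_iff]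
    filter_upwards [hcongr (Lp.coeFn_smul r f)] with t ht
    by_cases h : t ∈ E
    · simp [h, ht h, mul_left_comm]
    · simp [h]
  · change ‖(hind f).toL1 _‖ = ‖f‖
    rw [L1.norm_eq_integral_norm, L1.norm_eq_integral_norm]
    have h1 : ∫ t, ‖(hind f).toL1 _ t‖ ∂mu
        = ∫ t in E, (mu.real E)⁻¹ * ‖f (τ t)‖ ∂mu := by
      rw [← integral_indicator hE]
      refine integral_congr_ae ?_
      filter_upwards [(hind f).coeFn_toL1] with t ht
      rw [ht]
      by_cases h : t ∈ E <;> simp [h]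
    have h2 : ∫ t in E, ‖f (τ t)‖ ∂mu = mu.real E * ∫ t, ‖f t‖ ∂mu := by
      have := integral_map (μ := mu.restrict E) (φ := τ) (f := fun s => ‖f s‖) hτ.aemeasurable
        (Lp.stronglyMeasurable f).norm.aestronglyMeasurable
      rw [← this, hmap, integral_smul_measure, smul_eq_mul]
      rfl
    rw [h1, integral_const_mul, h2, inv_mul_cancel_left₀ hpos.ne']

/-- A bounded linear map into `c₀` built from a bounded pointwise null sequence of functionals. -/
theorem exists_map_to_zeroAtInfty {X : Type*} [NormedAddCommGroup X] [NormedSpace ℝ X]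
    {x : ℕ → X →L[ℝ] ℝ} {K : ℝ} (hK : 0 ≤ K) (hxK : ∀ n, ‖x n‖ ≤ K)
    (hx : ∀ v, Tendsto (fun n => x n v) atTop (𝓝 0)) :
    ∃ B : X →L[ℝ] C₀(ℕ, ℝ), ∀ v n, B v n = x n v := by
  let L : X →ₗ[ℝ] C₀(ℕ, ℝ) :=
    { toFun := fun v =>
        { toFun := fun n => x n v
          continuous_toFun := continuous_of_discreteTopology
          zero_at_infty' := by
            rw [cocompact_eq_cofinite, Nat.cofinite_eq_atTop]
            exact hx v }
      map_add' := fun v w => by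
        ext n
        simp
      map_smul' := fun r v => by
        ext n
        simp }
  refine ⟨L.mkContinuous K fun v => ?_, fun v n => rfl⟩
  rw [← ZeroAtInftyContinuousMap.norm_toBCF_eq_norm,
    BoundedContinuousFunction.norm_le (by positivity)]
  exact fun n => (x n).le_of_opNorm_le (hxK n) v

theorem tendsto_zero_of_denseRange {X : Type*} [NormedAddCommGroup X] [NormedSpace ℝ X]
    {x : ℕ → X →L[ℝ] ℝ} {K : ℝ} (hxK : ∀ n, ‖x n‖ ≤ K) {d : ℕ → X} (hd : DenseRange d)
    (hxd : ∀ n, ∀ i < n, x n (d i) = 0) (v : X) : Tendsto (fun n => x n v) atTop (𝓝 0) := by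
  rw [Metric.tendsto_atTop]
  intro ε hε
  have hK1 : 0 < |K| + 1 := by positivity
  obtain ⟨i, hi⟩ := hd.exists_dist_lt v (div_pos hε hK1)
  refine ⟨i + 1, fun n hn => ?_⟩
  rw [dist_zero_right, show x n v = x n (v - d i) by rw [map_sub, hxd n i hn, sub_zero]]
  rw [dist_eq_norm, lt_div_iff₀ hK1] at hi
  have h1 := (x n).le_of_opNorm_le (hxK n) (v - d i)
  nlinarith [le_abs_self K, norm_nonneg (v - d i)]

end Embedding

/-- If `X` is a separable Banach space and `T : L₁ → X` is a bounded linear operator which is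
not completely continuous, then there exist a linear isometric embedding `A : L₁ → L₁` and a
bounded linear operator `B : X → c₀` such that `(B (T (A f)))_n = ∫ r_n f dμ` for every
`f ∈ L₁` and every `n ≥ 0`; that is, `T₀` factors through `T` with the right-hand factor
taking values in `c₀` (sequences tending to `0` with the sup norm). -/
theorem universal_factorization_c0 (X : Type*) [NormedAddCommGroup X] [NormedSpace ℝ X]
    [CompleteSpace X] [TopologicalSpace.SeparableSpace X]
    (T : Lp ℝ 1 mu →L[ℝ] X) (hT : ¬ CompletelyContinuous T) :
    ∃ (A : Lp ℝ 1 mu →ₗᵢ[ℝ] Lp ℝ 1 mu) (B : X →L[ℝ] C₀(ℕ, ℝ)),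
      ∀ (f : Lp ℝ 1 mu) (n : ℕ), B (T (A f)) n = ∫ t, rademacher n t * f t ∂mu := by
  obtain ⟨E, c, hE, hEpos, hc, s, hs⟩ := exists_dyadicStages hT (TopologicalSpace.denseSeq X)
  obtain ⟨B, hB⟩ := exists_map_to_zeroAtInfty (x := fun n => (s n).x) (by norm_num)
    (fun n => (s n).norm_x_le) (tendsto_zero_of_denseRange (fun n => (s n).norm_x_le)
      (TopologicalSpace.denseRange_denseSeq X) fun n => (s n).x_eq_zero)
  choose τ hτlim hτ using fun t => exists_dyadic_limit (idx := fun n => (s n).idx t)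
    fun n => (hs n).2 t
  have hτm : Measurable τ := measurable_of_tendsto_metrizable
    (fun n => (measurable_from_nat.comp (s n).measurable_idx).div_const (2 ^ n : ℝ))
    (tendsto_pi_nhds.2 hτlim)
  have hsum {v : ℝ → ℝ} (hv : BddMeas v) {b : ℝ} (hb : ∀ᶠ n in atTop, ∀ k < 2 ^ n,
      ∫ t in E ∩ (s n).idx ⁻¹' {k}, v t ∂mu = b / 2 ^ n) (f : BoundedContinuousFunction ℝ ℝ) :
      ∫ t in E, v t * f (τ t) ∂mu = b * ∫ t, f t ∂mu := by
    refine tendsto_nhds_unique (tendsto_dyadic_sum (ν := mu.restrict E)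
      (fun n => (s n).measurable_idx) (fun n => ae_of_all _ (s n).idx_lt) (ae_of_all _ hτlim) hv
      (hb.mono fun n hn k hk => ?_) f) (tendsto_dyadic_sum_mu f b)
    rw [Measure.restrict_restrict ((s n).measurable_idx (measurableSet_singleton k)),
      Set.inter_comm]
    exact hn k hk
  have hmap : (mu.restrict E).map τ = mu E • mu := by
    have : IsFiniteMeasure (mu E • mu) := Measure.smul_finite _ (measure_ne_top _ _)
    refine ext_of_forall_integral_eq_of_IsFiniteMeasure fun f => ?_
    rw [integral_map hτm.aemeasurable f.continuous.aestronglyMeasurable, integral_smul_measure]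
    have := hsum (BddMeas.const 1) (b := mu.real E) (Eventually.of_forall fun n k hk => by
      simp [(s n).measure_cell k hk]) f
    rw [← Measure.real]
    simpa using this
  obtain ⟨A, hA⟩ := exists_isometry_of_map_eq hE hEpos hτm hmap
  have hq : Measure.QuasiMeasurePreserving τ (mu.restrict E) mu :=
    ⟨hτm, by rw [hmap]; exact Measure.smul_absolutelyContinuous⟩
  have hAint (v : ℝ → ℝ) (f : Lp ℝ 1 mu) :
      ∫ t, v t * A f t ∂mu = (mu.real E)⁻¹ * ∫ t in E, v t * f (τ t) ∂mu := by
    rw [← integral_const_mul, ← integral_indicator hE]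
    refine integral_congr_ae ?_
    filter_upwards [hA f] with t ht
    rw [ht]
    by_cases h : t ∈ E <;> simp [h, mul_left_comm]
  have hmono : Monotone fun n => (s n).fns := monotone_nat_of_le_succ fun n => (hs n).1
  have horth n (f : Lp ℝ 1 mu) :
      ∫ t, ((s n).y t - c * (-1) ^ (s n).idx t) * A f t ∂mu = 0 := by
    obtain ⟨hvm, K, hK⟩ := (s n).bddMeas_fns _ (s n).sub_mem_fns
    obtain ⟨φ, -, hφ⟩ := exists_dual_of_bounded (μ := mu) hvm (abs_nonneg K)
      fun t => (hK t).trans (le_abs_self K)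
    rw [← hφ]
    have hdense := BoundedContinuousFunction.toLp_denseRange (p := 1) ℝ mu ℝ (by norm_num)
    refine congrFun (hdense.equalizer (φ.continuous.comp A.continuous) continuous_const
      (funext fun f => ?_)) f
    simp only [Function.comp_apply]
    rw [hφ, hAint, mul_eq_zero]
    right
    rw [integral_congr_ae (g := fun t => ((s n).y t - c * (-1) ^ (s n).idx t) * f (τ t)),
      hsum ⟨hvm, K, hK⟩ (b := 0), zero_mul]
    · filter_upwards [eventually_ge_atTop n] with m hm k hk
      rw [(s m).integral_fns k hk _ (hmono hm (s n).sub_mem_fns), zero_div]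
    · filter_upwards [hq.ae_eq_comp (BoundedContinuousFunction.coeFn_toLp (p := 1) (μ := mu)
        (𝕜 := ℝ) f)] with t ht
      exact congrArg _ ht
  refine ⟨A, c⁻¹ • B, fun f n => ?_⟩
  have hsign : BddMeas fun t => (-1 : ℝ) ^ (s n).idx t :=
    ⟨(measurable_from_nat (f := fun k => (-1 : ℝ) ^ k)).comp (s n).measurable_idx, 1, by simp⟩
  have hAf := L1.integrable_coeFn (A f)
  have h1 : ∫ t, (s n).y t * A f t ∂mu = c * ∫ t, (-1) ^ (s n).idx t * A f t ∂mu := by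
    rw [← sub_eq_zero, ← integral_const_mul, ← integral_sub ((s n).bddMeas_y.integrable_mul hAf)
      ((hsign.integrable_mul hAf).const_mul c), ← horth n f]
    congr 1
    funext t
    ring
  have h2 : ∫ t in E, (-1) ^ (s n).idx t * f (τ t) ∂mu
      = mu.real E * ∫ t, rademacher n t * f t ∂mu := by
    have hr : Measurable (rademacher n) := by
      unfold rademacher
      exact (measurable_from_top (f := fun k : ℤ => (-1 : ℝ) ^ k)).comp
        (Int.measurable_floor.comp (measurable_id.const_mul _))
    have h3 := integral_map (μ := mu.restrict E) (f := fun t => rademacher n t * f t)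
      hτm.aemeasurable
      (hr.mul (Lp.stronglyMeasurable f).measurable).aestronglyMeasurable
    rw [hmap, integral_smul_measure, smul_eq_mul] at h3
    refine Eq.trans (integral_congr_ae ?_) h3.symm
    filter_upwards [hq.ae ae_forall_two_pow_mul_ne] with t ht
    rw [rademacher_eq_of_le (hτ t n).1 (hτ t n).2 (ht n _)]
  calc (c⁻¹ • B) (T (A f)) n = c⁻¹ * (s n).x (T (A f)) := by
        rw [← hB]
        rfl
    _ = ∫ t, rademacher n t * f t ∂mu := by
        rw [(s n).x_apply, h1, hAint, h2, inv_mul_cancel_left₀ hc.ne',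
          inv_mul_cancel_left₀ hEpos.ne']
end

section
/- There does not exist a universal non-completely-continuous operator. That is, there do not exist Banach spaces X and Z and a bounded linear operator S : X → Z which is not completely continuous such that for every pair of Banach spaces W, V and every bounded linear operator U : W → V that is not completely continuous, there exist bounded linear operators A : X → W and B : V → Z with B ∘ U ∘ A = S. -/
open Filter Topology

open MeasureTheory in
/-- On a compact space, every positive linear functional on `C(K, ℝ)` is sequentially continuous
under pointwise convergence of uniformly bounded nonnegative sequences to zero. -/
theorem tendsto_zero_of_positive_functional {K : Type*} [TopologicalSpace K] [CompactSpace K]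
    [T2Space K] (Λ : C(K, ℝ) →ₗ[ℝ] ℝ) (hΛ : ∀ f, 0 ≤ f → 0 ≤ Λ f) {e : ℕ → C(K, ℝ)}
    (h0 : ∀ n x, 0 ≤ e n x) (h1 : ∀ n x, e n x ≤ 1)
    (hlim : ∀ x, Tendsto (fun n => e n x) atTop (𝓝 0)) :
    Tendsto (fun n => Λ (e n)) atTop (𝓝 0) := by
  borelize K
  let L : CompactlySupportedContinuousMap K ℝ →ₚ[ℝ] ℝ :=
    { toFun := fun g => Λ g.toContinuousMap
      map_add' := fun f g => Λ.map_add f.toContinuousMap g.toContinuousMap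
      map_smul' := fun c g => Λ.map_smul c g.toContinuousMap
      monotone' := fun f g hfg => by
        have := hΛ (g.toContinuousMap - f.toContinuousMap) fun x => sub_nonneg.2 (hfg x)
        rw [map_sub] at this
        exact sub_nonneg.1 this }
  have hint : ∀ n, Λ (e n) = ∫ x, e n x ∂(RealRMK.rieszMeasure L) := fun n =>
    (RealRMK.integral_rieszMeasure L
      ⟨e n, HasCompactSupport.of_compactSpace _⟩).symm
  simp_rw [hint]
  rw [← integral_zero K ℝ (μ := RealRMK.rieszMeasure L)]
  refine tendsto_integral_of_dominated_convergence (fun _ => 1)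
    (fun n => (e n).continuous.aestronglyMeasurable) (integrable_const _) (fun n => ?_)
    (.of_forall hlim)
  exact .of_forall fun x => by rw [Real.norm_of_nonneg (h0 n x)]; exact h1 n x

/-- A functional on `C(K, ℝ)` cannot stay above `ε > 0` along a nonnegative bounded pointwise null
sequence: otherwise separation would yield a positive functional with the same property. -/
theorem eventually_lt_of_tendsto_pointwise {K : Type*} [TopologicalSpace K]
    [CompactSpace K] [T2Space K] (φ : C(K, ℝ) →L[ℝ] ℝ) {e : ℕ → C(K, ℝ)}
    (h0 : ∀ n x, 0 ≤ e n x) (h1 : ∀ n x, e n x ≤ 1)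
    (hlim : ∀ x, Tendsto (fun n => e n x) atTop (𝓝 0)) {ε : ℝ} (hε : 0 < ε) :
    ∀ᶠ n in atTop, φ (e n) < ε := by
  by_contra hcon
  have hfreq : ∃ᶠ n in atTop, ε ≤ φ (e n) := by
    simpa only [Filter.not_eventually, not_lt] using hcon
  set c : ℝ := ε / (‖φ‖ + 1) with hc
  have hφ : 0 < ‖φ‖ + 1 := by positivity
  have hcpos : 0 < c := by positivity
  let D : Set C(K, ℝ) := {f | Set.MapsTo f Set.univ (Set.Iio c)}
  let G : Set C(K, ℝ) := {g | (∀ x, 0 ≤ g x) ∧ ε ≤ φ g}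
  have hDopen : IsOpen D := ContinuousMap.isOpen_setOfPred_mapsTo isCompact_univ isOpen_Iio
  have hDconv : Convex ℝ D := fun f hf g hg a b ha hb hab x hx =>
    convex_Iio c (hf hx) (hg hx) ha hb hab
  have hGconv : Convex ℝ G := by
    rintro f ⟨hf, hf'⟩ g ⟨hg, hg'⟩ a b ha hb hab
    refine ⟨fun x => ?_, ?_⟩
    · have := mul_nonneg ha (hf x)
      have := mul_nonneg hb (hg x)
      simp only [ContinuousMap.add_apply, ContinuousMap.smul_apply, smul_eq_mul]
      positivity
    · simp only [map_add, map_smul, smul_eq_mul]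
      have : ε = a * ε + b * ε := by rw [← add_mul, hab, one_mul]
      rw [this]
      gcongr
  have hdisj : Disjoint D G := by
    rw [Set.disjoint_left]
    rintro g hD ⟨hg, hg'⟩
    have hlt : ‖g‖ < c := (ContinuousMap.norm_lt_iff g hcpos).2 fun x => by
      rw [Real.norm_of_nonneg (hg x)]
      exact hD (Set.mem_univ x)
    have h2 : φ g ≤ ‖φ‖ * ‖g‖ := (le_abs_self _).trans (φ.le_opNorm g)
    have h3 : (‖φ‖ + 1) * ‖g‖ < ε := by
      rwa [hc, lt_div_iff₀ hφ, mul_comm] at hlt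
    nlinarith [norm_nonneg g]
  obtain ⟨Λ, u, hu, hu'⟩ := geometric_hahn_banach_open hDconv hDopen hGconv hdisj
  have hupos : 0 < u := by
    simpa using hu 0 (fun x _ => hcpos)
  have hΛ : ∀ f, 0 ≤ f → 0 ≤ Λ.toLinearMap f := by
    intro f hf
    by_contra! hneg
    change Λ f < 0 at hneg
    have := hu ((u / Λ f) • f) fun x _ => by
      have h4 : (u / Λ f) * f x ≤ 0 :=
        mul_nonpos_of_nonpos_of_nonneg (div_nonpos_of_nonneg_of_nonpos hupos.le hneg.le) (hf x)
      exact h4.trans_lt hcpos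
    rw [map_smul, smul_eq_mul, div_mul_cancel₀ _ hneg.ne] at this
    exact lt_irrefl _ this
  have ht := tendsto_zero_of_positive_functional Λ.toLinearMap hΛ h0 h1 hlim
  obtain ⟨n, hn, hn'⟩ := (hfreq.and_eventually (ht.eventually_lt_const hupos)).exists
  exact absurd (hu' (e n) ⟨h0 n, hn⟩) (not_le.2 hn')

/-- A uniformly bounded nonnegative sequence in `C(K, ℝ)` converging pointwise to zero converges
weakly to zero. -/
theorem weakly_tendsto_zero_of_tendsto_pointwise {K : Type*} [TopologicalSpace K]
    [CompactSpace K] [T2Space K] (φ : C(K, ℝ) →L[ℝ] ℝ) {e : ℕ → C(K, ℝ)}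
    (h0 : ∀ n x, 0 ≤ e n x) (h1 : ∀ n x, e n x ≤ 1)
    (hlim : ∀ x, Tendsto (fun n => e n x) atTop (𝓝 0)) :
    Tendsto (fun n => φ (e n)) atTop (𝓝 0) := by
  rw [Metric.tendsto_nhds]
  intro ε hε
  filter_upwards [eventually_lt_of_tendsto_pointwise φ h0 h1 hlim hε,
    eventually_lt_of_tendsto_pointwise (-φ) h0 h1 hlim hε] with n hn hn'
  rw [Real.dist_eq, sub_zero, abs_lt]
  rw [neg_apply] at hn'
  constructor <;> linarith

/-- The sets all of whose finite subsets lie in `𝓕`, as a subset of the Cantor space. -/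
def familyClosure (𝓕 : Set (Finset ℕ)) : Set (ℕ → Bool) :=
  {s | ∀ F : Finset ℕ, (∀ k ∈ F, s k = true) → F ∈ 𝓕}

theorem isClosed_familyClosure (𝓕 : Set (Finset ℕ)) : IsClosed (familyClosure 𝓕) := by
  have : familyClosure 𝓕 = ⋂ F ∈ 𝓕ᶜ, ⋃ k ∈ F, {s | s k = false} := by
    ext s
    simp only [familyClosure, Set.mem_ofPred_eq, Set.mem_iInter, Set.mem_iUnion, Set.mem_compl_iff]
    refine forall_congr' fun F => ?_
    rw [← not_imp_not]
    simp
  rw [this]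
  refine isClosed_biInter fun F _ => F.finite_toSet.isClosed_biUnion fun k _ => ?_
  exact isClosed_eq (continuous_apply k) continuous_const

instance (𝓕 : Set (Finset ℕ)) : CompactSpace (familyClosure 𝓕) :=
  isCompact_iff_compactSpace.1 (isClosed_familyClosure 𝓕).isCompact

/-- A finite set in a hereditary family, as a point of the closure of the family. -/
def familyPoint {𝓕 : Set (Finset ℕ)} (hered : IsLowerSet 𝓕) (F : 𝓕) : familyClosure 𝓕 :=
  ⟨fun k => decide (k ∈ F.1), fun G hG => hered (fun k hk => by simpa using hG k hk) F.2⟩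

/-- The functions on the closure of the family which are additive on the members of the family. -/
def familySubmodule {𝓕 : Set (Finset ℕ)} (hered : IsLowerSet 𝓕) (hsingle : ∀ k, {k} ∈ 𝓕) :
    Submodule ℝ C(familyClosure 𝓕, ℝ) where
  carrier := {f | ∀ F : 𝓕, f (familyPoint hered F) =
    ∑ k ∈ F.1, f (familyPoint hered ⟨{k}, hsingle k⟩)}
  add_mem' := fun hf hg F => by simp [hf F, hg F, Finset.sum_add_distrib]
  zero_mem' := fun F => by simp
  smul_mem' := fun c f hf F => by simp [hf F, Finset.mul_sum]

section FamilySpace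

variable {𝓕 : Set (Finset ℕ)} {hered : IsLowerSet 𝓕} {hsingle : ∀ k, {k} ∈ 𝓕}

theorem isClosed_familySubmodule :
    IsClosed (familySubmodule hered hsingle : Set C(familyClosure 𝓕, ℝ)) := by
  have : (familySubmodule hered hsingle : Set C(familyClosure 𝓕, ℝ)) =
      ⋂ F : 𝓕, {f | f (familyPoint hered F) =
        ∑ k ∈ F.1, f (familyPoint hered ⟨{k}, hsingle k⟩)} := by
    ext f
    simp [familySubmodule]
  rw [this]
  exact isClosed_iInter fun F => isClosed_eq (by fun_prop) (by fun_prop)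

/-- The Banach space of functions which are additive on the members of the family. -/
def FamilySpace (hered : IsLowerSet 𝓕) (hsingle : ∀ k, {k} ∈ 𝓕) : Type :=
  familySubmodule hered hsingle

noncomputable instance : NormedAddCommGroup (FamilySpace hered hsingle) :=
  inferInstanceAs (NormedAddCommGroup (familySubmodule hered hsingle))

noncomputable instance : NormedSpace ℝ (FamilySpace hered hsingle) :=
  inferInstanceAs (NormedSpace ℝ (familySubmodule hered hsingle))

instance : CompleteSpace (FamilySpace hered hsingle) :=
  isClosed_familySubmodule.completeSpace_coe

/-- The `k`-th coordinate functional. -/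
noncomputable def familyCoord (hered : IsLowerSet 𝓕) (hsingle : ∀ k, {k} ∈ 𝓕) (k : ℕ) :
    FamilySpace hered hsingle →L[ℝ] ℝ :=
  (ContinuousMap.evalCLM ℝ (familyPoint hered ⟨{k}, hsingle k⟩)).comp
    (familySubmodule hered hsingle).subtypeL

theorem familyCoord_apply (k : ℕ) (f : FamilySpace hered hsingle) :
    familyCoord hered hsingle k f = f.1 (familyPoint hered ⟨{k}, hsingle k⟩) := rfl

theorem sum_familyCoord (F : 𝓕) (f : FamilySpace hered hsingle) :
    ∑ k ∈ F.1, familyCoord hered hsingle k f = f.1 (familyPoint hered F) :=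
  (f.2 F).symm

theorem abs_sum_familyCoord_le {F : Finset ℕ} (hF : F ∈ 𝓕) (f : FamilySpace hered hsingle) :
    |∑ k ∈ F, familyCoord hered hsingle k f| ≤ ‖f‖ := by
  rw [sum_familyCoord ⟨F, hF⟩ f]
  exact f.1.norm_coe_le_norm _

theorem abs_familyCoord_le (k : ℕ) (f : FamilySpace hered hsingle) :
    |familyCoord hered hsingle k f| ≤ ‖f‖ := by
  have h := abs_sum_familyCoord_le (hsingle k) f
  rwa [Finset.sum_singleton] at h

theorem exists_abs_sum_familyCoord_tail_le (f : FamilySpace hered hsingle) {ε : ℝ} (hε : 0 < ε) :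
    ∃ N, ∀ F ∈ 𝓕, (∀ k ∈ F, N ≤ k) → |∑ k ∈ F, familyCoord hered hsingle k f| ≤ ε := by
  have hempty : ∅ ∈ 𝓕 := hered (Finset.empty_subset {0}) (hsingle 0)
  set p := familyPoint hered ⟨∅, hempty⟩ with hp
  have hf0 : f.1 p = 0 := by simpa using f.2 ⟨∅, hempty⟩
  by_contra! hcon
  choose F hF hFN hlt using hcon
  have hlim : Tendsto (fun N => familyPoint hered ⟨F N, hF N⟩) atTop (𝓝 p) := by
    rw [tendsto_subtype_rng, tendsto_pi_nhds]
    intro k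
    refine tendsto_const_nhds.congr' ?_
    filter_upwards [eventually_gt_atTop k] with N hN
    have : k ∉ F N := fun hk => (hFN N k hk).not_gt hN
    simp [hp, familyPoint, this]
  have hlim' := ((f.1.continuous.tendsto p).comp hlim).abs
  rw [hf0, abs_zero] at hlim'
  obtain ⟨N, hN⟩ := (hlim'.eventually_lt_const hε).exists
  have := hlt N
  rw [sum_familyCoord ⟨F N, hF N⟩ f] at this
  exact this.not_gt hN

/-- The `k`-th unit vector. -/
def familyUnit (hered : IsLowerSet 𝓕) (hsingle : ∀ k, {k} ∈ 𝓕) (k : ℕ) :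
    FamilySpace hered hsingle :=
  ⟨⟨fun s => if s.1 k then 1 else 0,
    (continuous_of_discreteTopology (f := fun b : Bool => if b then (1 : ℝ) else 0)).comp
      ((continuous_apply k).comp continuous_subtype_val)⟩, fun F => by
    simp [familyPoint]⟩

theorem familyCoord_familyUnit (k : ℕ) :
    familyCoord hered hsingle k (familyUnit hered hsingle k) = 1 := by
  rw [familyCoord_apply]
  simp [familyUnit, familyPoint]

theorem weakly_tendsto_familyUnit
    (hcompact : ∀ s : Set ℕ, (∀ F : Finset ℕ, ↑F ⊆ s → F ∈ 𝓕) → s.Finite)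
    (φ : FamilySpace hered hsingle →L[ℝ] ℝ) :
    Tendsto (fun k => φ (familyUnit hered hsingle k)) atTop (𝓝 0) := by
  obtain ⟨ψ, hψ, -⟩ := exists_extension_norm_eq (familySubmodule hered hsingle) φ
  refine Tendsto.congr (fun k => hψ (familyUnit hered hsingle k)) ?_
  refine weakly_tendsto_zero_of_tendsto_pointwise ψ (fun k s => ?_) (fun k s => ?_) fun s => ?_
  · dsimp [familyUnit]; split_ifs <;> norm_num
  · dsimp [familyUnit]; split_ifs <;> norm_num
  · have hfin : {k | s.1 k = true}.Finite := hcompact _ fun F hF => s.2 F fun k hk => hF hk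
    refine tendsto_const_nhds.congr' ?_
    have := hfin.compl_mem_cofinite
    rw [Nat.cofinite_eq_atTop] at this
    filter_upwards [this] with k hk
    have : s.1 k = false := by simpa using hk
    simp [familyUnit, this]

/-- The formal inclusion into the bounded sequences. -/
noncomputable def familyInclusion (hered : IsLowerSet 𝓕) (hsingle : ∀ k, {k} ∈ 𝓕) :
    FamilySpace hered hsingle →L[ℝ] BoundedContinuousFunction ℕ ℝ :=
  LinearMap.mkContinuous
    { toFun := fun f => BoundedContinuousFunction.ofNormedAddCommGroupDiscrete
        (fun k => familyCoord hered hsingle k f) ‖f‖ fun k => abs_familyCoord_le k f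
      map_add' := fun f g => BoundedContinuousFunction.ext fun k =>
        (familyCoord hered hsingle k).map_add f g
      map_smul' := fun c f => BoundedContinuousFunction.ext fun k =>
        (familyCoord hered hsingle k).map_smul c f } 1 fun f => by
    rw [one_mul]
    exact (BoundedContinuousFunction.norm_le (norm_nonneg f)).2 fun k => abs_familyCoord_le k f

theorem familyInclusion_apply (f : FamilySpace hered hsingle) (k : ℕ) :
    familyInclusion hered hsingle f k = familyCoord hered hsingle k f := rfl

theorem not_completelyContinuous_familyInclusion
    (hcompact : ∀ s : Set ℕ, (∀ F : Finset ℕ, ↑F ⊆ s → F ∈ 𝓕) → s.Finite) :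
    ¬ CompletelyContinuous (familyInclusion hered hsingle) := by
  intro h
  have h1 := h (familyUnit hered hsingle) 0 fun φ => by
    simpa using weakly_tendsto_familyUnit hcompact φ
  rw [map_zero] at h1
  obtain ⟨k, hk⟩ := (h1.norm.eventually_lt_const
    (by simp : ‖(0 : BoundedContinuousFunction ℕ ℝ)‖ < 1)).exists
  have h2 := (familyInclusion hered hsingle (familyUnit hered hsingle k)).norm_coe_le_norm k
  rw [familyInclusion_apply, familyCoord_familyUnit, norm_one] at h2
  exact h2.not_gt hk

end FamilySpace

section diagonalFamily

variable {X : Type*} [NormedAddCommGroup X] [NormedSpace ℝ X]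

/-- The finite sets `F` for which some functional `φ`, with norm controlled by the elements of `F`,
is at least one on vectors `x (n k)`, for `k ∈ F` not maximal, where the value of `n` at an
element of `F` is at most the next element of `F`. -/
def diagonalFamily (x : ℕ → X) : Set (Finset ℕ) :=
  {F | ∃ (φ : X →L[ℝ] ℝ) (n : ℕ → ℕ), Set.InjOn n F ∧
    ∀ k ∈ F, ∀ l ∈ F, k < l → ‖φ‖ ≤ k ∧ n k ≤ l ∧ 1 ≤ φ (x (n k))}

theorem isLowerSet_diagonalFamily (x : ℕ → X) : IsLowerSet (diagonalFamily x) := by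
  rintro F G hGF ⟨φ, n, hn, h⟩
  exact ⟨φ, n, hn.mono (by exact_mod_cast hGF),
    fun k hk l hl => h k (hGF hk) l (hGF hl)⟩

theorem singleton_mem_diagonalFamily (x : ℕ → X) (k : ℕ) : {k} ∈ diagonalFamily x := by
  refine ⟨0, id, Set.injOn_id _, fun i hi j hj hij => ?_⟩
  rw [Finset.mem_singleton] at hi hj
  omega

theorem exists_eventually_eq_of_eventually_le {α : Type*} (𝒰 : Ultrafilter α)
    {f : α → ℕ} {m : ℕ} (h : ∀ᶠ a in 𝒰, f a ≤ m) : ∃ N, ∀ᶠ a in 𝒰, f a = N := by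
  obtain ⟨N, -, hN⟩ := (Set.finite_Iic m).isCompact.ultrafilter_le_nhds (𝒰.map f)
    (le_principal_iff.2 h)
  rw [nhds_discrete, Ultrafilter.coe_map] at hN
  exact ⟨N, tendsto_pure.1 hN⟩

theorem finite_of_forall_finset_mem_diagonalFamily {x : ℕ → X}
    (hx : ∀ φ : X →L[ℝ] ℝ, Tendsto (fun n => φ (x n)) atTop (𝓝 0)) (s : Set ℕ)
    (hs : ∀ F : Finset ℕ, ↑F ⊆ s → F ∈ diagonalFamily x) : s.Finite := by
  classical
  by_contra hinf
  have hinf : s.Infinite := hinf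
  have hmem := fun r : ℕ => hs ((Finset.range r).filter (· ∈ s)) (by
    intro k hk
    simp only [Finset.coe_filter] at hk
    exact hk.2)
  choose φ n hinj hφ using hmem
  have hin : ∀ k ∈ s, ∀ᶠ r in (hyperfilter ℕ : Filter ℕ),
      k ∈ (Finset.range r).filter (· ∈ s) := by
    intro k hk
    have := (eventually_gt_atTop k).filter_mono Nat.hyperfilter_le_atTop
    filter_upwards [this] with r hr
    simpa [hk] using hr
  have hpair : ∀ k ∈ s, ∀ l ∈ s, k < l → ∀ᶠ r in (hyperfilter ℕ : Filter ℕ),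
      ‖φ r‖ ≤ k ∧ n r k ≤ l ∧ 1 ≤ φ r (x (n r k)) := by
    intro k hk l hl hkl
    filter_upwards [hin k hk, hin l hl] with r hkr hlr using hφ r k hkr l hlr hkl
  obtain ⟨k₀, hk₀⟩ := hinf.nonempty
  obtain ⟨l₀, hl₀, hkl₀⟩ := hinf.exists_gt k₀
  obtain ⟨ψ, -, hψ⟩ := (WeakDual.isCompact_closedBall (𝕜 := ℝ) (E := X) 0 k₀).ultrafilter_le_nhds
    ((hyperfilter ℕ).map fun r => StrongDual.toWeakDual (φ r)) (by
      rw [le_principal_iff]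
      refine (hpair k₀ hk₀ l₀ hl₀ hkl₀).mono fun r hr => ?_
      simpa using hr.1)
  have hlim : ∀ y : X, Tendsto (fun r => φ r y) (hyperfilter ℕ : Filter ℕ) (𝓝 (ψ y)) :=
    fun y => ((WeakDual.eval_continuous y).tendsto ψ).comp hψ
  have hN : ∀ k, ∃ N, k ∈ s → ∀ᶠ r in (hyperfilter ℕ : Filter ℕ), n r k = N := by
    intro k
    by_cases hk : k ∈ s
    · obtain ⟨l, hl, hkl⟩ := hinf.exists_gt k
      obtain ⟨N, hN⟩ := exists_eventually_eq_of_eventually_le (hyperfilter ℕ)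
        ((hpair k hk l hl hkl).mono fun r hr => hr.2.1)
      exact ⟨N, fun _ => hN⟩
    · exact ⟨0, fun h => absurd h hk⟩
  choose N hN using hN
  have hNinj : Set.InjOn N s := by
    intro k hk l hl hkl
    obtain ⟨r, h1, h2, h3, h4⟩ :=
      ((hN k hk).and ((hN l hl).and ((hin k hk).and (hin l hl)))).exists
    exact hinj r h3 h4 (by rw [h1, h2, hkl])
  have hone : Set.MapsTo N s {m | 1 ≤ ψ (x m)} := by
    intro k hk
    obtain ⟨l, hl, hkl⟩ := hinf.exists_gt k
    refine ge_of_tendsto (hlim (x (N k))) ?_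
    filter_upwards [hN k hk, hpair k hk l hl hkl] with r h1 h2
    rw [← h1]
    exact h2.2.2
  have hinf' : {m | 1 ≤ ψ (x m)}.Infinite := Set.infinite_of_injOn_mapsTo hNinj hone hinf
  obtain ⟨m, hm, hm'⟩ := ((Nat.frequently_atTop_iff_infinite.2 hinf').and_eventually
    ((hx (WeakDual.toStrongDual ψ)).eventually_lt_const one_pos)).exists
  exact hm'.not_ge hm

/-- The Banach space associated with `diagonalFamily x`. -/
abbrev DiagonalSpace (x : ℕ → X) : Type :=
  FamilySpace (isLowerSet_diagonalFamily x) (singleton_mem_diagonalFamily x)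

/-- The coordinates of the space `DiagonalSpace x`. -/
noncomputable abbrev diagonalCoord (x : ℕ → X) (k : ℕ) : DiagonalSpace x →L[ℝ] ℝ :=
  familyCoord (isLowerSet_diagonalFamily x) (singleton_mem_diagonalFamily x) k

theorem exists_large_coord_and_small_head {x : ℕ → X}
    (hx : ∀ φ : X →L[ℝ] ℝ, Tendsto (fun n => φ (x n)) atTop (𝓝 0))
    (T : X →L[ℝ] DiagonalSpace x) {δ : ℝ} (hδ : 0 < δ)
    (hbig : ∃ᶠ n in atTop, ∃ k, δ ≤ diagonalCoord x k (T (x n))) (N : ℕ) :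
    ∃ n k, N ≤ n ∧ N ≤ k ∧ δ ≤ diagonalCoord x k (T (x n)) ∧
      ∑ j ∈ Finset.range N, |diagonalCoord x j (T (x n))| ≤ δ / 4 := by
  have hlim : Tendsto (fun n => ∑ j ∈ Finset.range N, |diagonalCoord x j (T (x n))|)
      atTop (𝓝 0) := by
    rw [← Finset.sum_const_zero (s := Finset.range N)]
    refine tendsto_finsetSum _ fun j _ => ?_
    have := (hx ((diagonalCoord x j).comp T)).abs
    rwa [abs_zero] at this
  obtain ⟨n, ⟨k, hk⟩, hn, hNn⟩ := (hbig.and_eventually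
    ((hlim.eventually_lt_const (by positivity : 0 < δ / 4)).and (eventually_ge_atTop N))).exists
  refine ⟨n, k, hNn, ?_, hk, hn.le⟩
  by_contra! hkN
  have h1 := Finset.single_le_sum (f := fun j => |diagonalCoord x j (T (x n))|)
    (fun j _ => abs_nonneg _) (Finset.mem_range.2 hkN)
  have h2 := le_abs_self (diagonalCoord x k (T (x n)))
  linarith

/-- A finite stage of the diagonal construction is realized by a functional on `X`. -/
theorem insert_mem_diagonalFamily {x : ℕ → X} (T : X →L[ℝ] DiagonalSpace x) {δ : ℝ} (hδ : 0 < δ)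
    {n k : ℕ → ℕ} (hn : StrictMono n) (hk : StrictMono k)
    (hk0 : 2 / δ * ‖T‖ ≤ k 0) (hnk : ∀ i j, i < j → n i ≤ k j) {r : ℕ}
    (hF : (Finset.range r).image k ∈ diagonalFamily x)
    (hlarge : ∀ i < r, δ / 2 ≤ ∑ j ∈ Finset.range r, diagonalCoord x (k j) (T (x (n i)))) :
    (Finset.range (r + 1)).image k ∈ diagonalFamily x := by
  have hinv : ∀ i, Function.invFun k (k i) = i := Function.leftInverse_invFun hk.injective
  let ψ : X →L[ℝ] ℝ :=
    (2 / δ) • (∑ a ∈ (Finset.range r).image k, diagonalCoord x a).comp T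
  have hψ : ∀ y, ψ y = 2 / δ * ∑ a ∈ (Finset.range r).image k, diagonalCoord x a (T y) := by
    intro y
    simp [ψ]
  have hψnorm : ‖ψ‖ ≤ 2 / δ * ‖T‖ := by
    refine ψ.opNorm_le_bound (by positivity) fun y => ?_
    rw [hψ, norm_mul, Real.norm_of_nonneg (by positivity : 0 ≤ 2 / δ), mul_assoc]
    gcongr
    exact (abs_sum_familyCoord_le hF (T y)).trans (T.le_opNorm y)
  refine ⟨ψ, fun a => n (Function.invFun k a), ?_, ?_⟩
  · intro a ha b hb hab
    simp only [Finset.coe_image, Set.mem_image] at ha hb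
    obtain ⟨i, -, rfl⟩ := ha
    obtain ⟨j, -, rfl⟩ := hb
    simp only [hinv] at hab
    rw [hn.injective hab]
  · intro a ha b hb hab
    simp only [Finset.mem_image, Finset.mem_range] at ha hb
    obtain ⟨i, -, rfl⟩ := ha
    obtain ⟨j, hj, rfl⟩ := hb
    have hij : i < j := hk.lt_iff_lt.1 hab
    simp only [hinv]
    refine ⟨(hψnorm.trans hk0).trans (Nat.cast_le.2 (hk.monotone (Nat.zero_le i))),
      hnk i j hij, ?_⟩
    rw [hψ, Finset.sum_image hk.injective.injOn]
    have := hlarge i (by omega)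
    calc (1 : ℝ) = 2 / δ * (δ / 2) := by field_simp
      _ ≤ _ := by gcongr

/-- No operator into `DiagonalSpace x` has images of `x n` with large coordinates. -/
theorem not_frequently_large_coord {x : ℕ → X}
    (hx : ∀ φ : X →L[ℝ] ℝ, Tendsto (fun n => φ (x n)) atTop (𝓝 0))
    (T : X →L[ℝ] DiagonalSpace x) {δ : ℝ} (hδ : 0 < δ) :
    ¬ ∃ᶠ n in atTop, ∃ k, δ ≤ diagonalCoord x k (T (x n)) := by
  intro hbig
  choose ν κ hν hκ hδκ hhead using exists_large_coord_and_small_head hx T hδ hbig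
  choose τ hτ using fun n => exists_abs_sum_familyCoord_tail_le (T (x n))
    (by positivity : 0 < δ / 4)
  let N : ℕ → ℕ := fun i => Nat.rec ⌈2 / δ * ‖T‖⌉₊
    (fun _ M => max (max M (ν M + 1)) (max (κ M + 1) (τ (ν M)))) i
  have hNsucc : ∀ i, N (i + 1) =
      max (max (N i) (ν (N i) + 1)) (max (κ (N i) + 1) (τ (ν (N i)))) := fun i => rfl
  have hNmono : Monotone N := monotone_nat_of_le_succ fun i => by rw [hNsucc]; simp
  have hnN : ∀ i j, i < j → ν (N i) < N j := fun i j hij =>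
    lt_of_lt_of_le (by rw [hNsucc]; simp) (hNmono (Nat.succ_le_of_lt hij))
  have hkN : ∀ i j, i < j → κ (N i) < N j := fun i j hij =>
    lt_of_lt_of_le (by rw [hNsucc]; simp) (hNmono (Nat.succ_le_of_lt hij))
  have hτN : ∀ i j, i < j → τ (ν (N i)) ≤ N j := fun i j hij =>
    le_trans (by rw [hNsucc]; simp) (hNmono (Nat.succ_le_of_lt hij))
  have hn : StrictMono fun i => ν (N i) := fun i j hij => (hnN i j hij).trans_le (hν _)
  have hk : StrictMono fun i => κ (N i) := fun i j hij => (hkN i j hij).trans_le (hκ _)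
  have hk0 : 2 / δ * ‖T‖ ≤ κ (N 0) :=
    (Nat.le_ceil _).trans (Nat.cast_le.2 (hκ (N 0)))
  have hmem : ∀ r, (Finset.range r).image (fun i => κ (N i)) ∈ diagonalFamily x := by
    intro r
    induction r with
    | zero =>
      exact isLowerSet_diagonalFamily x (by simp) (singleton_mem_diagonalFamily x 0)
    | succ r ih =>
      refine insert_mem_diagonalFamily T hδ hn hk hk0
        (fun i j hij => (hnN i j hij).le.trans (hκ _)) ih fun i hi => ?_
      set f := T (x (ν (N i)))
      have hsplit : ∑ j ∈ Finset.range r, diagonalCoord x (κ (N j)) f =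
          ∑ j ∈ Finset.range i, diagonalCoord x (κ (N j)) f + diagonalCoord x (κ (N i)) f +
            ∑ j ∈ Finset.Ico (i + 1) r, diagonalCoord x (κ (N j)) f := by
        rw [← Finset.sum_range_succ, Finset.sum_range_add_sum_Ico _ (Nat.succ_le_of_lt hi)]
      have h1 : |∑ j ∈ Finset.range i, diagonalCoord x (κ (N j)) f| ≤ δ / 4 := by
        refine (Finset.abs_sum_le_sum_abs _ _).trans (le_trans ?_ (hhead (N i)))
        rw [← Finset.sum_image (f := fun a => |diagonalCoord x a f|)
          (g := fun j => κ (N j)) hk.injective.injOn]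
        refine Finset.sum_le_sum_of_subset_of_nonneg ?_ fun _ _ _ => abs_nonneg _
        intro a ha
        simp only [Finset.mem_image, Finset.mem_range] at ha ⊢
        obtain ⟨j, hj, rfl⟩ := ha
        exact hkN j i hj
      have h2 : |∑ j ∈ Finset.Ico (i + 1) r, diagonalCoord x (κ (N j)) f| ≤ δ / 4 := by
        rw [← Finset.sum_image (f := fun a => diagonalCoord x a f)
          (g := fun j => κ (N j)) hk.injective.injOn]
        refine hτ (ν (N i)) _ (isLowerSet_diagonalFamily x ?_ ih) ?_
        · refine Finset.image_subset_image fun j hj => ?_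
          exact Finset.mem_range.2 (Finset.mem_Ico.1 hj).2
        · intro a ha
          simp only [Finset.mem_image, Finset.mem_Ico] at ha
          obtain ⟨j, hj, rfl⟩ := ha
          exact (hτN i j (by omega)).trans (hκ _)
      have h3 := hδκ (N i)
      rw [hsplit]
      have h4 := (abs_le.1 h1).1
      have h5 := (abs_le.1 h2).1
      change δ ≤ diagonalCoord x (κ (N i)) f at h3
      linarith
  refine Set.infinite_range_of_injective hk.injective
    (finite_of_forall_finset_mem_diagonalFamily hx _ fun F hF => ?_)
  obtain ⟨r, hr⟩ : ∃ r, F ⊆ (Finset.range r).image fun i => κ (N i) := by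
    refine ⟨F.sup id + 1, fun a ha => ?_⟩
    obtain ⟨i, rfl⟩ := hF ha
    refine Finset.mem_image_of_mem _ (Finset.mem_range.2 ?_)
    have : κ (N i) ≤ F.sup id := Finset.le_sup (f := id) ha
    have := hk.id_le i
    simp only [id] at this
    omega
  exact isLowerSet_diagonalFamily x hr (hmem r)

end diagonalFamily

theorem exists_weakly_null_of_not_completelyContinuous {X Z : Type*} [NormedAddCommGroup X]
    [NormedSpace ℝ X] [NormedAddCommGroup Z] [NormedSpace ℝ Z] {S : X →L[ℝ] Z}
    (hS : ¬ CompletelyContinuous S) :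
    ∃ (x : ℕ → X) (δ : ℝ), 0 < δ ∧
      (∀ φ : X →L[ℝ] ℝ, Tendsto (fun n => φ (x n)) atTop (𝓝 0)) ∧ ∀ n, δ ≤ ‖S (x n)‖ := by
  unfold CompletelyContinuous at hS
  push Not at hS
  obtain ⟨x, x₀, hx, hSx⟩ := hS
  rw [Metric.tendsto_nhds] at hSx
  push Not at hSx
  obtain ⟨δ, hδ, hfreq⟩ := hSx
  obtain ⟨σ, hσ, hδσ⟩ := extraction_of_frequently_atTop hfreq
  refine ⟨fun n => x (σ n) - x₀, δ, hδ, fun φ => ?_, fun n => ?_⟩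
  · have := ((hx φ).comp hσ.tendsto_atTop).sub_const (φ x₀)
    simpa using this
  · rw [map_sub, ← dist_eq_norm]
    exact hδσ n

/-- There does not exist a universal non-completely-continuous operator: there are no Banach
spaces `X`, `Z` and non-completely-continuous bounded linear operator `S : X → Z` such
that for every non-completely-continuous bounded linear operator `U : W → V` between Banach
spaces there are bounded linear operators `A : X → W` and `B : V → Z` with `B ∘ U ∘ A = S`. -/
theorem no_universal_non_completelyContinuous :
    ∀ (X Z : Type) [NormedAddCommGroup X] [NormedSpace ℝ X] [CompleteSpace X]
      [NormedAddCommGroup Z] [NormedSpace ℝ Z] [CompleteSpace Z]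
      (S : X →L[ℝ] Z),
      ¬ (¬ CompletelyContinuous S ∧
          ∀ (W V : Type) [NormedAddCommGroup W] [NormedSpace ℝ W] [CompleteSpace W]
            [NormedAddCommGroup V] [NormedSpace ℝ V] [CompleteSpace V]
            (U : W →L[ℝ] V), ¬ CompletelyContinuous U →
            ∃ (A : X →L[ℝ] W) (B : V →L[ℝ] Z), ∀ x : X, B (U (A x)) = S x) := by
  intro X Z _ _ _ _ _ _ S ⟨hS, huniv⟩
  obtain ⟨x, δ, hδ, hx, hSx⟩ := exists_weakly_null_of_not_completelyContinuous hS
  obtain ⟨A, B, hAB⟩ := huniv (DiagonalSpace x) (BoundedContinuousFunction ℕ ℝ)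
    (familyInclusion (isLowerSet_diagonalFamily x) (singleton_mem_diagonalFamily x))
    (not_completelyContinuous_familyInclusion (finite_of_forall_finset_mem_diagonalFamily hx))
  have hB : 0 < ‖B‖ + 1 := by positivity
  have hη : 0 < δ / (‖B‖ + 1) := by positivity
  have hbig : ∀ n, ∃ k, δ / (‖B‖ + 1) / 2 ≤ |diagonalCoord x k (A (x n))| := by
    intro n
    by_contra! hcon
    have h1 := (BoundedContinuousFunction.norm_le (f := familyInclusion
      (isLowerSet_diagonalFamily x) (singleton_mem_diagonalFamily x) (A (x n)))
      (half_pos hη).le).2 fun k => (hcon k).le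
    have h2 := hSx n
    rw [← hAB] at h2
    have h3 := h2.trans (B.le_opNorm _)
    have h4 := h3.trans (mul_le_mul_of_nonneg_left h1 (norm_nonneg B))
    have h5 : (‖B‖ + 1) * (δ / (‖B‖ + 1)) = δ := by field_simp
    nlinarith [norm_nonneg B]
  have h1 := not_frequently_large_coord hx A (half_pos hη)
  have h2 := not_frequently_large_coord hx (-A) (half_pos hη)
  rw [not_frequently] at h1 h2
  obtain ⟨n, hn, hn'⟩ := (h1.and h2).exists
  obtain ⟨k, hk⟩ := hbig n
  rcases le_abs.1 hk with h | h
  · exact hn ⟨k, h⟩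
  · exact hn' ⟨k, by rwa [neg_apply, map_neg]⟩
end
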